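/- arXiv:2510.22578 — 2 statements merged into one kernel-verified Lean document; each statement's English description precedes it below -/
import Mathlib

section
/- There exist universal constants c > 0 and C > 0 such that for every δ ∈ (0, 0.05) and all positive integers m, n with m ≥ C·log(1/δ)·δ^{−2}·n: if A ∈ ℂ^{m×n} is a standard complex Gaussian random matrix, then with probability at least 1 − 2·exp(−c·δ²·m) there exist constants L, U > 0 with √(4/(4−π)) ≤ U/L ≤ √(4/(4−π)) + δ such that A satisfies the phaseless bi-Lipschitz condition with constants L, U on all of ℂ^n, i.e., L·dist(x,y) ≤ ‖|Ax| − |Ay|‖₂ ≤ U·dist(x,y) for all x, y ∈ ℂ^n. -/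
open MeasureTheory ProbabilityTheory Real Finset

/-- The `ℓ_q` (quasi-)norm `(∑ i, ‖x i‖^q)^{1/q}` of a vector with entries in `𝕜 ∈ {ℝ, ℂ}`. -/
noncomputable def lpNorm {ι : Type*} [Fintype ι] {𝕜 : Type*} [RCLike 𝕜] (q : ℝ) (x : ι → 𝕜) : ℝ :=
  (∑ i, ‖x i‖ ^ q) ^ (1 / q)

open Classical in
/-- The number of nonzero entries of a vector. -/
noncomputable def l0Norm {ι : Type*} [Fintype ι] {𝕜 : Type*} [RCLike 𝕜] (x : ι → 𝕜) : ℕ :=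
  (Finset.univ.filter fun i => x i ≠ 0).card

/-- The phase distance `dist_q(x,y) = inf_{|c|=1} ‖x - c • y‖_q`. -/
noncomputable def phaseDist {ι : Type*} [Fintype ι] {𝕜 : Type*} [RCLike 𝕜] (q : ℝ)
    (x y : ι → 𝕜) : ℝ :=
  sInf {d | ∃ c : 𝕜, ‖c‖ = 1 ∧ d = lpNorm q (fun i => x i - c * y i)}

/-- The best `k`-term approximation error `σ_k(x)_q = inf {‖x - z‖_q : ‖z‖₀ ≤ k}`. -/
noncomputable def sigmaK {ι : Type*} [Fintype ι] {𝕜 : Type*} [RCLike 𝕜] (k : ℕ) (q : ℝ)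
    (x : ι → 𝕜) : ℝ :=
  sInf {d | ∃ z : ι → 𝕜, l0Norm z ≤ k ∧ d = lpNorm q (fun i => x i - z i)}

/-- The entrywise modulus `|Ax|` of the matrix-vector product `Ax`. -/
noncomputable def absMv {m n : ℕ} {𝕜 : Type*} [RCLike 𝕜] (A : Fin m → Fin n → 𝕜)
    (x : Fin n → 𝕜) : Fin m → ℝ :=
  fun i => ‖∑ j, A i j * x j‖

/-- `A` satisfies the phaseless bi-Lipschitz condition on `X` with constants `L, U`:
`L·dist(x,y) ≤ ‖|Ax| - |Ay|‖₂ ≤ U·dist(x,y)` for all `x, y ∈ X`. -/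
def PhaselessBiLip {m n : ℕ} {𝕜 : Type*} [RCLike 𝕜] (A : Fin m → Fin n → 𝕜)
    (X : Set (Fin n → 𝕜)) (L U : ℝ) : Prop :=
  ∀ x ∈ X, ∀ y ∈ X,
    L * phaseDist 2 x y ≤ lpNorm 2 (fun i => absMv A x i - absMv A y i) ∧
    lpNorm 2 (fun i => absMv A x i - absMv A y i) ≤ U * phaseDist 2 x y

/-- The law of a standard complex Gaussian random matrix `A ∈ ℂ^{m×n}`: the pushforward, under
the entrywise map `(x,y) ↦ x + i·y`, of the product over the `m·n` entries of the product of two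
real Gaussian measures with mean `0` and variance `1/2`. -/
noncomputable def gaussMatrixComplex (m n : ℕ) : Measure (Fin m → Fin n → ℂ) :=
  Measure.map (fun g : Fin m → Fin n → ℝ × ℝ => fun i j => ((g i j).1 : ℂ) + (g i j).2 * Complex.I)
    (Measure.pi fun _ : Fin m => Measure.pi fun _ : Fin n =>
      (gaussianReal 0 (1/2)).prod (gaussianReal 0 (1/2)))

/-- The law of a standard complex Gaussian variable. -/
noncomputable def complexGaussian : Measure ℂ :=
  ((gaussianReal 0 (1/2)).prod (gaussianReal 0 (1/2))).map
    fun g : ℝ × ℝ => (g.1 : ℂ) + g.2 * Complex.I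

lemma measurable_ofReal_add_ofReal_mul_I :
    Measurable fun g : ℝ × ℝ => (g.1 : ℂ) + g.2 * Complex.I := by fun_prop

instance : IsProbabilityMeasure complexGaussian :=
  Measure.isProbabilityMeasure_map measurable_ofReal_add_ofReal_mul_I.aemeasurable

lemma complexGaussian_eq_withDensity :
    complexGaussian = volume.withDensity
      fun z : ℂ => ENNReal.ofReal (π⁻¹ * rexp (-‖z‖ ^ 2)) := by
  have hv : ((1 / 2 : NNReal)) ≠ 0 := by norm_num
  have hfun : (fun g : ℝ × ℝ => (g.1 : ℂ) + g.2 * Complex.I)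
      = Complex.measurableEquivRealProd.symm := by
    ext g
    simp [Complex.measurableEquivRealProd]
    apply Complex.ext <;> simp
  rw [complexGaussian, gaussianReal_of_var_ne_zero _ hv,
    prod_withDensity (measurable_gaussianPDF _ _) (measurable_gaussianPDF _ _), hfun]
  ext s hs
  rw [MeasurableEquiv.map_apply, withDensity_apply _ hs, withDensity_apply _
    (Complex.measurableEquivRealProd.symm.measurable hs)]
  rw [← (Complex.volume_preserving_equiv_real_prod.symm).setLIntegral_comp_preimage_emb
    (MeasurableEquiv.measurableEmbedding _)]
  refine lintegral_congr fun g => ?_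
  rw [gaussianPDF, gaussianPDF, ← ENNReal.ofReal_mul (gaussianPDFReal_nonneg _ _ _)]
  congr 1
  rw [← hfun]
  simp only [gaussianPDFReal, Complex.sq_norm, Complex.normSq_add_mul_I]
  have : √(2 * π * ((1 / 2 : NNReal) : ℝ)) = √π := by congr 1; push_cast; ring
  rw [this]
  have h2 : (√π)⁻¹ * (√π)⁻¹ = π⁻¹ := by rw [← mul_inv, Real.mul_self_sqrt pi_pos.le]
  calc _ = ((√π)⁻¹ * (√π)⁻¹) * (rexp (-(g.1 - 0) ^ 2 / (2 * ((1 / 2 : NNReal) : ℝ)))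
        * rexp (-(g.2 - 0) ^ 2 / (2 * ((1 / 2 : NNReal) : ℝ)))) := by ring
    _ = _ := by
      rw [h2, ← Real.exp_add]; congr 2; push_cast; ring

lemma integral_complexGaussian (f : ℂ → ℝ) :
    ∫ z, f z ∂complexGaussian = π⁻¹ * ∫ z : ℂ, f z * rexp (-‖z‖ ^ 2) := by
  rw [complexGaussian_eq_withDensity, integral_withDensity_eq_integral_toReal_smul
    (by fun_prop) (by simp), ← integral_const_mul]
  refine integral_congr_ae (.of_forall fun z => ?_)
  simp only [smul_eq_mul]
  rw [ENNReal.toReal_ofReal (by positivity)]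
  ring

lemma integral_norm_pow_complexGaussian (k : ℕ) :
    ∫ z, ‖z‖ ^ k ∂complexGaussian = Real.Gamma ((k + 2) / 2) := by
  have h := Complex.integral_rpow_mul_exp_neg_mul_rpow (p := 2) (q := k) (b := 1) (by norm_num)
    (by have : (0 : ℝ) ≤ k := by positivity
        linarith) one_pos
  simp only [Real.rpow_natCast, Real.rpow_ofNat, neg_mul, one_mul, Real.one_rpow] at h
  rw [integral_complexGaussian, h]
  field_simp

lemma integral_exp_mul_norm_sq_complexGaussian {t : ℝ} (ht : t < 1) :
    ∫ z, rexp (t * ‖z‖ ^ 2) ∂complexGaussian = (1 - t)⁻¹ := by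
  have h := Complex.integral_rpow_mul_exp_neg_mul_rpow (p := 2) (q := 0) (b := 1 - t)
    (by norm_num) (by norm_num) (by linarith)
  simp only [Real.rpow_ofNat, Real.rpow_zero, one_mul] at h
  rw [integral_complexGaussian]
  simp_rw [← Real.exp_add]
  have : ∀ z : ℂ, t * ‖z‖ ^ 2 + -‖z‖ ^ 2 = -(1 - t) * ‖z‖ ^ 2 := fun z => by ring
  simp_rw [this]
  rw [h]
  have h1 : (-(0 + 2) / 2 : ℝ) = -1 := by norm_num
  have h2 : ((0 + 2) / 2 : ℝ) = 1 := by norm_num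
  rw [h1, h2, Real.rpow_neg_one, Real.Gamma_one]
  field_simp

lemma integrable_norm_pow_complexGaussian (k : ℕ) :
    Integrable (fun z : ℂ => ‖z‖ ^ k) complexGaussian := by
  apply Integrable.of_integral_ne_zero
  rw [integral_norm_pow_complexGaussian]
  exact (Real.Gamma_pos_of_pos (by positivity)).ne'

lemma integral_norm_complexGaussian : ∫ z, ‖z‖ ∂complexGaussian = √π / 2 := by
  have h := integral_norm_pow_complexGaussian 1
  have h2 : (((1 : ℕ) : ℝ) + 2) / 2 = 1 / 2 + 1 := by norm_num
  rw [h2, Real.Gamma_add_one (by norm_num), Real.Gamma_one_half_eq] at h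
  simp only [pow_one] at h
  rw [h]; ring

lemma integral_norm_sq_complexGaussian : ∫ z, ‖z‖ ^ 2 ∂complexGaussian = 1 := by
  rw [integral_norm_pow_complexGaussian]
  norm_num

lemma integral_norm_pow_four_complexGaussian : ∫ z, ‖z‖ ^ 4 ∂complexGaussian = 2 := by
  rw [integral_norm_pow_complexGaussian]
  have := Real.Gamma_nat_eq_factorial 2
  norm_num at this ⊢

open scoped RealInnerProductSpace in
lemma charFun_complexGaussian (t : ℂ) :
    charFun complexGaussian t = Complex.exp (-(‖t‖ ^ 2 / 4 : ℝ)) := by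
  have h1 := charFun_gaussianReal (μ := 0) (v := 1 / 2) t.re
  have h2 := charFun_gaussianReal (μ := 0) (v := 1 / 2) t.im
  rw [charFun_apply_real] at h1 h2
  rw [charFun_apply, complexGaussian, integral_map
    measurable_ofReal_add_ofReal_mul_I.aemeasurable (by fun_prop)]
  have : ∀ g : ℝ × ℝ, Complex.exp (⟪(g.1 : ℂ) + g.2 * Complex.I, t⟫ * Complex.I)
      = Complex.exp (t.re * g.1 * Complex.I) * Complex.exp (t.im * g.2 * Complex.I) := by
    intro g
    rw [← Complex.exp_add, Complex.inner]
    congr 1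
    simp
    ring
  simp_rw [this]
  rw [integral_prod_mul (fun x : ℝ => Complex.exp (t.re * x * Complex.I))
    (fun x : ℝ => Complex.exp (t.im * x * Complex.I)), h1, h2, ← Complex.exp_add,
    Complex.sq_norm, Complex.normSq_apply]
  congr 1
  push_cast
  ring

/-- The law of a row with independent standard complex Gaussian entries. -/
noncomputable def complexGaussianRow (n : ℕ) : Measure (Fin n → ℂ) :=
  Measure.pi fun _ => complexGaussian

instance (n : ℕ) : IsProbabilityMeasure (complexGaussianRow n) := by
  unfold complexGaussianRow; infer_instance

lemma norm_sq_add_of_inner_eq_zero {n : ℕ} {x y : EuclideanSpace ℂ (Fin n)}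
    (hxy : inner ℂ x y = 0) (s t : ℂ) :
    ∑ j, ‖s * starRingEnd ℂ (x j) + t * starRingEnd ℂ (y j)‖ ^ 2
      = ‖x‖ ^ 2 * ‖s‖ ^ 2 + ‖y‖ ^ 2 * ‖t‖ ^ 2 := by
  have h : ∀ j, ‖s * starRingEnd ℂ (x j) + t * starRingEnd ℂ (y j)‖
      = ‖(starRingEnd ℂ s • x + starRingEnd ℂ t • y) j‖ := fun j => by
    rw [← RCLike.norm_conj]
    simp
  simp_rw [h]
  rw [← EuclideanSpace.norm_sq_eq, @norm_add_sq ℂ, inner_smul_left, inner_smul_right, hxy,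
    norm_smul, norm_smul, RCLike.norm_conj, RCLike.norm_conj]
  simp
  ring

open scoped RealInnerProductSpace in
/-- Orthogonal linear forms of a Gaussian row are independent complex Gaussians. -/
lemma map_pair_complexGaussianRow {n : ℕ} {x y : EuclideanSpace ℂ (Fin n)}
    (hxy : inner ℂ x y = 0) :
    (complexGaussianRow n).map (fun a => (∑ j, a j * x j, ∑ j, a j * y j))
      = (complexGaussian.map (‖x‖ • ·)).prod (complexGaussian.map (‖y‖ • ·)) := by
  have hm : Measurable fun a : Fin n → ℂ => (∑ j, a j * x j, ∑ j, a j * y j) := by fun_prop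
  have : IsProbabilityMeasure ((complexGaussianRow n).map
      (fun a => (∑ j, a j * x j, ∑ j, a j * y j))) :=
    Measure.isProbabilityMeasure_map hm.aemeasurable
  have h1 (r : ℝ) : IsProbabilityMeasure (complexGaussian.map (r • ·)) :=
    Measure.isProbabilityMeasure_map (by fun_prop)
  refine charFun_eq_prod_iff.1 fun t => ?_
  rw [charFun_map_smul, charFun_map_smul, charFun_complexGaussian, charFun_complexGaussian,
    ← Complex.exp_add, charFun_apply, integral_map (by fun_prop) (by fun_prop),
    integral_map (by fun_prop) (by fun_prop)]
  have h2 : ∀ a : Fin n → ℂ, Complex.exp (⟪WithLp.toLp 2 (∑ j, a j * x j, ∑ j, a j * y j), t⟫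
      * Complex.I) = ∏ j, Complex.exp (⟪a j, t.fst * starRingEnd ℂ (x j)
        + t.snd * starRingEnd ℂ (y j)⟫ * Complex.I) := by
    intro a
    rw [← Complex.exp_sum, ← Finset.sum_mul, WithLp.prod_inner_apply]
    congr 2
    rw [← Complex.ofReal_sum]
    congr 1
    simp only [sum_inner, ← Finset.sum_add_distrib]
    refine Finset.sum_congr rfl fun j _ => ?_
    simp only [Complex.inner]
    simp
    ring
  simp_rw [h2, complexGaussianRow]
  rw [integral_fintype_prod_eq_prod (fun j (z : ℂ) => Complex.exp (⟪z, t.fst * starRingEnd ℂ (x j)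
        + t.snd * starRingEnd ℂ (y j)⟫ * Complex.I))]
  simp_rw [← charFun_apply, charFun_complexGaussian]
  rw [← Complex.exp_sum, Finset.sum_neg_distrib, ← Complex.ofReal_sum, ← Finset.sum_div,
    norm_sq_add_of_inner_eq_zero hxy, ← neg_add, ← Complex.ofReal_add]
  congr 3
  simp only [norm_smul, norm_norm]
  change _ = (‖x‖ * ‖t.fst‖) ^ 2 / 4 + (‖y‖ * ‖t.snd‖) ^ 2 / 4
  ring

lemma integral_pair_complexGaussianRow {n : ℕ} {x y : EuclideanSpace ℂ (Fin n)}
    (hxy : inner ℂ x y = 0) {f : ℂ × ℂ → ℝ} (hf : Measurable f) :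
    ∫ a, f (∑ j, a j * x j, ∑ j, a j * y j) ∂complexGaussianRow n
      = ∫ p : ℂ × ℂ, f (‖x‖ • p.1, ‖y‖ • p.2) ∂complexGaussian.prod complexGaussian := by
  have hm : Measurable fun a : Fin n → ℂ => (∑ j, a j * x j, ∑ j, a j * y j) := by fun_prop
  rw [← integral_map hm.aemeasurable hf.aestronglyMeasurable, map_pair_complexGaussianRow hxy,
    Measure.map_prod_map _ _ (by fun_prop) (by fun_prop),
    integral_map (by fun_prop) hf.aestronglyMeasurable]
  rfl
open Metric Module in
lemma card_le_of_separated_of_subset_closedBall {V : Type*} [NormedAddCommGroup V]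
    [NormedSpace ℝ V] [FiniteDimensional ℝ V] {η : ℝ} (hη : 0 < η) (s : Finset V)
    (hs : ∀ p ∈ s, ‖p‖ ≤ 1) (hsep : ∀ p ∈ s, ∀ q ∈ s, p ≠ q → η ≤ ‖p - q‖) :
    (s.card : ℝ) ≤ (1 + 2 / η) ^ finrank ℝ V := by
  borelize V
  let μ : Measure V := Measure.addHaar
  have hδ : 0 < η / 2 := by positivity
  have hρ : 0 < 1 + η / 2 := by positivity
  have D : Set.Pairwise (s : Set V) (Function.onFun Disjoint fun c => ball (c : V) (η / 2)) := by
    rintro c hc d hd hcd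
    apply ball_disjoint_ball
    rw [dist_eq_norm]
    linarith [hsep c hc d hd hcd]
  have hsub : (⋃ c ∈ s, ball (c : V) (η / 2)) ⊆ ball (0 : V) (1 + η / 2) := by
    refine Set.iUnion₂_subset fun x hx => ball_subset_ball' ?_
    rw [dist_zero_right]
    linarith [hs x hx]
  have I : (s.card : ENNReal) * ENNReal.ofReal ((η / 2) ^ finrank ℝ V) * μ (ball 0 1) ≤
      ENNReal.ofReal ((1 + η / 2) ^ finrank ℝ V) * μ (ball 0 1) :=
    calc
      _ = μ (⋃ c ∈ s, ball (c : V) (η / 2)) := by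
        rw [measure_biUnion_finset D fun c _ => measurableSet_ball]
        simp only [μ.addHaar_ball_of_pos _ hδ, Finset.sum_const, nsmul_eq_mul, mul_assoc]
      _ ≤ μ (ball (0 : V) (1 + η / 2)) := measure_mono hsub
      _ = _ := by simp only [μ.addHaar_ball_of_pos _ hρ]
  have J := (ENNReal.mul_le_mul_iff_left (measure_ball_pos _ _ zero_lt_one).ne'
    measure_ball_lt_top.ne).1 I
  have K := ENNReal.toReal_le_of_le_ofReal (by positivity) J
  rw [ENNReal.toReal_mul, ENNReal.toReal_natCast, ENNReal.toReal_ofReal (by positivity),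
    ← le_div_iff₀ (by positivity), ← div_pow] at K
  have : 1 + 2 / η = (1 + η / 2) / (η / 2) := by field_simp; ring
  rwa [this]

/-- A subset of the unit ball admits an internal `η`-net of controlled size. -/
lemma exists_net_of_norm_le_one {V : Type*} [NormedAddCommGroup V]
    [NormedSpace ℝ V] [FiniteDimensional ℝ V] {η : ℝ} (hη : 0 < η) (K : Set V)
    (hK : ∀ p ∈ K, ‖p‖ ≤ 1) :
    ∃ s : Finset V, (s.card : ℝ) ≤ (1 + 2 / η) ^ Module.finrank ℝ V ∧ (∀ p ∈ s, p ∈ K) ∧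
      ∀ p ∈ K, ∃ q ∈ s, ‖p - q‖ ≤ η := by
  classical
  let P : ℕ → Prop := fun k => ∃ s : Finset V, s.card = k ∧ (∀ p ∈ s, p ∈ K) ∧
    ∀ p ∈ s, ∀ q ∈ s, p ≠ q → η ≤ ‖p - q‖
  have hbd : ∀ k, P k → k ≤ ⌊(1 + 2 / η) ^ Module.finrank ℝ V⌋₊ := by
    rintro k ⟨s, rfl, h1, h2⟩
    exact Nat.le_floor (card_le_of_separated_of_subset_closedBall hη s
      (fun p hp => hK p (h1 p hp)) h2)
  have h0 : P 0 := ⟨∅, by simp⟩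
  obtain ⟨s, hcard, hsK, hsep⟩ := Nat.findGreatest_spec (P := P) (hbd 0 h0) h0
  refine ⟨s, card_le_of_separated_of_subset_closedBall hη s
      (fun p hp => hK p (hsK p hp)) hsep, hsK, fun p hp => ?_⟩
  by_contra! hcon
  have hps : p ∉ s := fun h => by
    have := hcon p h
    simp at this
    linarith
  have hP : P (s.card + 1) := by
    refine ⟨insert p s, Finset.card_insert_of_notMem hps, ?_, ?_⟩
    · simpa [hp] using hsK
    · intro a ha b hb hab
      rcases Finset.mem_insert.1 ha with ha | ha <;> rcases Finset.mem_insert.1 hb with hb | hb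
      · exact absurd (ha.trans hb.symm) hab
      · rw [ha]; exact (hcon b hb).le
      · rw [hb, norm_sub_rev]; exact (hcon a ha).le
      · exact hsep a ha b hb hab
  have := Nat.le_findGreatest (hbd _ hP) hP
  omega

/-- Chernoff's bound for sums over independent copies. -/
lemma measureReal_pi_le_exp_of_integral_exp_le {Ω : Type*} [MeasurableSpace Ω] (ν : Measure Ω)
    [IsProbabilityMeasure ν] {f : Ω → ℝ} (hf : Integrable (fun ω => rexp (f ω)) ν) {b : ℝ}
    (hb : ∫ ω, rexp (f ω) ∂ν ≤ rexp b) (m : ℕ) (t : ℝ) :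
    (Measure.pi fun _ : Fin m => ν).real {A | t ≤ ∑ i, f (A i)} ≤ rexp (m * b - t) := by
  have hint : Integrable (fun A : Fin m → Ω => ∏ i, rexp (f (A i)))
      (Measure.pi fun _ : Fin m => ν) := Integrable.fintype_prod fun _ => hf
  have h := mul_meas_ge_le_integral_of_nonneg
    (.of_forall fun A => Finset.prod_nonneg fun i _ => (Real.exp_pos (f (A i))).le) hint (rexp t)
  rw [integral_fintype_prod_eq_pow (ι := Fin m) (fun ω => rexp (f ω))] at h
  have hset : {A : Fin m → Ω | rexp t ≤ ∏ i, rexp (f (A i))} = {A | t ≤ ∑ i, f (A i)} := by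
    ext A
    simp [← Real.exp_sum]
  rw [hset, Fintype.card_fin, mul_comm, ← le_div_iff₀ (Real.exp_pos _)] at h
  refine h.trans ?_
  rw [Real.exp_sub, Real.exp_nat_mul]
  gcongr

lemma exp_neg_le_one_sub_add_sq_div_two {u : ℝ} (hu : 0 ≤ u) :
    rexp (-u) ≤ 1 - u + u ^ 2 / 2 := by
  rw [Real.exp_neg, inv_le_iff_one_le_mul₀ (Real.exp_pos _)]
  have h := Real.quadratic_le_exp_of_nonneg hu
  nlinarith [sq_nonneg (u ^ 2), sq_nonneg (u - 1)]

lemma integral_norm_pow_mul_norm_pow (i j : ℕ) :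
    ∫ p : ℂ × ℂ, ‖p.1‖ ^ i * ‖p.2‖ ^ j ∂complexGaussian.prod complexGaussian
      = (∫ z, ‖z‖ ^ i ∂complexGaussian) * ∫ z, ‖z‖ ^ j ∂complexGaussian :=
  integral_prod_mul (fun z : ℂ => ‖z‖ ^ i) (fun z : ℂ => ‖z‖ ^ j)

lemma integrable_norm_pow_mul_norm_pow (i j : ℕ) :
    Integrable (fun p : ℂ × ℂ => ‖p.1‖ ^ i * ‖p.2‖ ^ j) (complexGaussian.prod complexGaussian) :=
  (integrable_norm_pow_complexGaussian i).mul_prod (integrable_norm_pow_complexGaussian j)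

lemma exp_neg_mul_sq_sub_le {t a b : ℝ} (ht : 0 ≤ t) (ha : 0 ≤ a) (hb : 0 ≤ b) :
    rexp (-(t * (a - b) ^ 2)) ≤
      1 - t * (a ^ 2 + b ^ 2 - 2 * (a * b)) + t ^ 2 / 2 * (a ^ 2 + b ^ 2) ^ 2 := by
  refine (exp_neg_le_one_sub_add_sq_div_two (by positivity)).trans ?_
  have h : ((a - b) ^ 2) ^ 2 ≤ (a ^ 2 + b ^ 2) ^ 2 := by
    gcongr
    nlinarith [mul_nonneg ha hb]
  have h2 := mul_le_mul_of_nonneg_left h (by positivity : 0 ≤ t ^ 2 / 2)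
  nlinarith

lemma integral_exp_neg_mul_sq_sub_le {t r s : ℝ} (ht : 0 ≤ t) (hr : 0 ≤ r) (hs : 0 ≤ s)
    (hrs : r ^ 2 + s ^ 2 = 1) :
    ∫ p : ℂ × ℂ, rexp (-(t * (‖r • p.1‖ - ‖s • p.2‖) ^ 2)) ∂complexGaussian.prod complexGaussian
      ≤ rexp (-(t * (1 - π / 4)) + t ^ 2) := by
  have hI := integrable_norm_pow_mul_norm_pow
  have hG : Integrable (fun p : ℂ × ℂ => 1 * (‖p.1‖ ^ 0 * ‖p.2‖ ^ 0)
      + (-(t * r ^ 2)) * (‖p.1‖ ^ 2 * ‖p.2‖ ^ 0) + (-(t * s ^ 2)) * (‖p.1‖ ^ 0 * ‖p.2‖ ^ 2)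
      + (2 * t * r * s) * (‖p.1‖ ^ 1 * ‖p.2‖ ^ 1) + (t ^ 2 / 2 * r ^ 4) * (‖p.1‖ ^ 4 * ‖p.2‖ ^ 0)
      + (t ^ 2 * r ^ 2 * s ^ 2) * (‖p.1‖ ^ 2 * ‖p.2‖ ^ 2)
      + (t ^ 2 / 2 * s ^ 4) * (‖p.1‖ ^ 0 * ‖p.2‖ ^ 4)) (complexGaussian.prod complexGaussian) := by
    apply_rules [Integrable.add, Integrable.const_mul, hI]
  refine (integral_mono_of_nonneg (.of_forall fun _ => (Real.exp_pos _).le) hG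
    (.of_forall fun p => ?_)).trans ?_
  · simp only [norm_smul, Real.norm_of_nonneg hr, Real.norm_of_nonneg hs]
    refine (exp_neg_mul_sq_sub_le ht (by positivity) (by positivity)).trans_eq ?_
    ring
  · have hπ : ∫ p : ℂ × ℂ, ‖p.1‖ ^ 1 * ‖p.2‖ ^ 1 ∂complexGaussian.prod complexGaussian
        = π / 4 := by
      rw [integral_norm_pow_mul_norm_pow]
      simp only [pow_one, integral_norm_complexGaussian]
      linear_combination Real.mul_self_sqrt pi_pos.le / 4
    rw [integral_add, integral_add, integral_add, integral_add, integral_add, integral_add]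
    · simp only [integral_const_mul, hπ, integral_norm_pow_mul_norm_pow,
        integral_norm_sq_complexGaussian, integral_norm_pow_four_complexGaussian]
      have h2 : 2 * (r * s) ≤ 1 := by nlinarith [sq_nonneg (r - s)]
      have h4 : 2 * r ^ 4 + 2 * r ^ 2 * s ^ 2 + 2 * s ^ 4 ≤ 2 := by
        have : (r ^ 2 + s ^ 2) ^ 2 = 1 := by rw [hrs]; norm_num
        nlinarith [mul_nonneg (sq_nonneg r) (sq_nonneg s)]
      have h5 : t ^ 2 / 2 * (2 * r ^ 4 + 2 * r ^ 2 * s ^ 2 + 2 * s ^ 4) ≤ t ^ 2 / 2 * 2 :=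
        mul_le_mul_of_nonneg_left h4 (by positivity)
      have h6 : t * (π / 4) * (2 * (r * s)) ≤ t * (π / 4) * 1 :=
        mul_le_mul_of_nonneg_left h2 (by positivity)
      refine le_trans ?_ (Real.add_one_le_exp _)
      simp only [pow_zero, integral_const, probReal_univ, smul_eq_mul]
      have h7 : t * (r ^ 2 + s ^ 2) = t := by rw [hrs, mul_one]
      linarith
    all_goals apply_rules [Integrable.add, Integrable.const_mul, hI]

lemma integral_exp_neg_mul_row_le {n : ℕ} {x y : EuclideanSpace ℂ (Fin n)}
    (hxy : inner ℂ x y = 0) (hn : ‖x‖ ^ 2 + ‖y‖ ^ 2 = 1) {t : ℝ} (ht : 0 ≤ t) :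
    ∫ a, rexp (-(t * (‖∑ j, a j * x j‖ - ‖∑ j, a j * y j‖) ^ 2)) ∂complexGaussianRow n
      ≤ rexp (-(t * (1 - π / 4)) + t ^ 2) := by
  rw [integral_pair_complexGaussianRow hxy
    (f := fun p => rexp (-(t * (‖p.1‖ - ‖p.2‖) ^ 2))) (by fun_prop)]
  exact integral_exp_neg_mul_sq_sub_le ht (norm_nonneg x) (norm_nonneg y) hn

lemma integral_exp_mul_row {n : ℕ} {x : EuclideanSpace ℂ (Fin n)} (hx : ‖x‖ ≤ 1) {t : ℝ}
    (ht : 0 ≤ t) (ht1 : t < 1) :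
    ∫ a, rexp (t * ‖∑ j, a j * x j‖ ^ 2) ∂complexGaussianRow n = (1 - t * ‖x‖ ^ 2)⁻¹ := by
  have hlt : t * ‖x‖ ^ 2 < 1 := 
    (mul_le_of_le_one_right ht (pow_le_one₀ (norm_nonneg _) hx)).trans_lt ht1
  rw [integral_pair_complexGaussianRow (inner_zero_right x)
    (f := fun p => rexp (t * ‖p.1‖ ^ 2)) (by fun_prop),
    ← integral_exp_mul_norm_sq_complexGaussian hlt,
    integral_fun_fst (fun z : ℂ => rexp (t * ‖‖x‖ • z‖ ^ 2))]
  simp [mul_pow, mul_assoc]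

lemma integral_exp_mul_row_le {n : ℕ} {x : EuclideanSpace ℂ (Fin n)} (hx : ‖x‖ ≤ 1) {t : ℝ}
    (ht : 0 ≤ t) (ht1 : t ≤ 1 / 4) :
    ∫ a, rexp (t * ‖∑ j, a j * x j‖ ^ 2) ∂complexGaussianRow n ≤ rexp (t + t ^ 2) := by
  rw [integral_exp_mul_row hx ht (by linarith)]
  have h1 : t * ‖x‖ ^ 2 ≤ t := mul_le_of_le_one_right ht (pow_le_one₀ (norm_nonneg _) hx)
  have h2 := exp_neg_le_one_sub_add_sq_div_two (by positivity : 0 ≤ t + t ^ 2)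
  have h3 : 1 - (t + t ^ 2) + (t + t ^ 2) ^ 2 / 2 ≤ 1 - t * ‖x‖ ^ 2 := by
    nlinarith [sq_nonneg t, mul_nonneg ht ht, mul_nonneg (sq_nonneg t) ht]
  rw [inv_le_comm₀ (by linarith) (Real.exp_pos _), ← Real.exp_neg]
  exact h2.trans h3

lemma measureReal_sum_sq_sub_le {n : ℕ} {x y : EuclideanSpace ℂ (Fin n)}
    (hxy : inner ℂ x y = 0) (hn : ‖x‖ ^ 2 + ‖y‖ ^ 2 = 1) (m : ℕ) {ε : ℝ} (hε : 0 ≤ ε) :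
    (Measure.pi fun _ : Fin m => complexGaussianRow n).real
      {A | ∑ i, (‖∑ j, A i j * x j‖ - ‖∑ j, A i j * y j‖) ^ 2 ≤ m * (1 - π / 4 - ε)}
        ≤ rexp (-(m * ε ^ 2 / 4)) := by
  have hint : Integrable (fun a : Fin n → ℂ =>
      rexp (-(ε / 2 * (‖∑ j, a j * x j‖ - ‖∑ j, a j * y j‖) ^ 2))) (complexGaussianRow n) := by
    refine Integrable.of_bound (by fun_prop) 1 (.of_forall fun a => ?_)
    rw [Real.norm_of_nonneg (Real.exp_pos _).le, Real.exp_le_one_iff, neg_nonpos]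
    positivity
  have h := measureReal_pi_le_exp_of_integral_exp_le _ hint
    (integral_exp_neg_mul_row_le hxy hn (by positivity)) m (-(ε / 2 * (m * (1 - π / 4 - ε))))
  refine le_trans (measureReal_mono fun A hA => ?_) (h.trans_eq ?_)
  · simp only [Set.mem_ofPred_eq, Finset.sum_neg_distrib, ← Finset.mul_sum] at hA ⊢
    exact neg_le_neg (mul_le_mul_of_nonneg_left hA (by positivity))
  · congr 1
    ring

lemma measureReal_le_sum_sq {n : ℕ} {x : EuclideanSpace ℂ (Fin n)} (hx : ‖x‖ ≤ 1)
    (m : ℕ) {ε : ℝ} (hε : 0 ≤ ε) (hε1 : ε ≤ 1 / 2) :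
    (Measure.pi fun _ : Fin m => complexGaussianRow n).real
      {A | m * (1 + ε) ≤ ∑ i, ‖∑ j, A i j * x j‖ ^ 2} ≤ rexp (-(m * ε ^ 2 / 4)) := by
  have hint : Integrable (fun a : Fin n → ℂ => rexp (ε / 2 * ‖∑ j, a j * x j‖ ^ 2))
      (complexGaussianRow n) := by
    apply Integrable.of_integral_ne_zero
    rw [integral_exp_mul_row hx (by positivity) (by linarith)]
    have : ε / 2 * ‖x‖ ^ 2 ≤ ε / 2 :=
      mul_le_of_le_one_right (by positivity) (pow_le_one₀ (norm_nonneg _) hx)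
    exact inv_ne_zero (by linarith)
  have h := measureReal_pi_le_exp_of_integral_exp_le _ hint
    (integral_exp_mul_row_le hx (by positivity) (by linarith)) m (ε / 2 * (m * (1 + ε)))
  refine le_trans (measureReal_mono fun A hA => ?_) (h.trans_eq ?_)
  · simp only [Set.mem_ofPred_eq, ← Finset.mul_sum] at hA ⊢
    exact mul_le_mul_of_nonneg_left hA (by positivity)
  · congr 1
    ring

/-- The entrywise modulus of a vector. -/
noncomputable def absVec {ι : Type*} [Fintype ι] (u : EuclideanSpace ℂ ι) : EuclideanSpace ℝ ι :=
  WithLp.toLp 2 fun i => ‖u i‖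

section absVec

variable {ι : Type*} [Fintype ι]

@[simp]
lemma absVec_apply (u : EuclideanSpace ℂ ι) (i : ι) : absVec u i = ‖u i‖ := rfl

lemma norm_absVec_sub_le (u v : EuclideanSpace ℂ ι) : ‖absVec u - absVec v‖ ≤ ‖u - v‖ := by
  rw [EuclideanSpace.norm_eq, EuclideanSpace.norm_eq]
  refine Real.sqrt_le_sqrt (Finset.sum_le_sum fun i _ => ?_)
  simp only [PiLp.sub_apply, absVec_apply, Real.norm_eq_abs]
  gcongr
  exact abs_norm_sub_norm_le _ _

lemma absVec_smul (c : ℂ) (u : EuclideanSpace ℂ ι) : absVec (c • u) = ‖c‖ • absVec u := by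
  ext i
  simp

lemma norm_absVec_sub_le_add (u v u' v' : EuclideanSpace ℂ ι) :
    ‖absVec u - absVec v‖ ≤ ‖absVec u' - absVec v'‖ + ‖u - u'‖ + ‖v - v'‖ := by
  have h : absVec u - absVec v = (absVec u' - absVec v') + (absVec u - absVec u')
      - (absVec v - absVec v') := by abel
  rw [h]
  refine (norm_sub_le _ _).trans (add_le_add ((norm_add_le _ _).trans ?_) (norm_absVec_sub_le _ _))
  gcongr
  exact norm_absVec_sub_le _ _

lemma sq_norm_add_sub_norm_sub (a b : ℂ) :
    (‖a + b‖ - ‖a - b‖) ^ 2 = 2 * (‖a‖ ^ 2 + ‖b‖ ^ 2 - ‖a ^ 2 - b ^ 2‖) := by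
  have h1 := parallelogram_law_with_norm ℝ a b
  have h2 : ‖a ^ 2 - b ^ 2‖ = ‖a + b‖ * ‖a - b‖ := by rw [← norm_mul]; congr 1; ring
  rw [h2]
  nlinarith

lemma abs_norm_add_sub_norm_sub_le (a b : ℂ) {s : ℝ} (hs : 1 ≤ s) :
    |‖a + b‖ - ‖a - b‖| ≤ |‖s * a + b‖ - ‖s * a - b‖| := by
  rw [← sq_le_sq, sq_norm_add_sub_norm_sub, sq_norm_add_sub_norm_sub]
  have h : (s * a) ^ 2 - b ^ 2 = ((s ^ 2 - 1 : ℝ) : ℂ) * a ^ 2 + (a ^ 2 - b ^ 2) := by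
    push_cast; ring
  have h2 := norm_add_le (((s ^ 2 - 1 : ℝ) : ℂ) * a ^ 2) (a ^ 2 - b ^ 2)
  rw [← h, norm_mul, Complex.norm_real, Real.norm_of_nonneg (by nlinarith), norm_pow] at h2
  rw [norm_mul, Complex.norm_real, Real.norm_of_nonneg (by linarith)]
  nlinarith

lemma norm_absVec_add_sub_absVec_sub_le (p w : EuclideanSpace ℂ ι) {s : ℝ} (hs : 1 ≤ s) :
    ‖absVec (p + w) - absVec (p - w)‖
      ≤ ‖absVec ((s : ℂ) • p + w) - absVec ((s : ℂ) • p - w)‖ := by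
  rw [EuclideanSpace.norm_eq, EuclideanSpace.norm_eq]
  refine Real.sqrt_le_sqrt (Finset.sum_le_sum fun i _ => ?_)
  simp only [PiLp.sub_apply, PiLp.add_apply, PiLp.smul_apply, absVec_apply, Real.norm_eq_abs,
    smul_eq_mul]
  exact pow_le_pow_left₀ (abs_nonneg _) (abs_norm_add_sub_norm_sub_le _ _ hs) 2

variable {E : Type*} [NormedAddCommGroup E] [InnerProductSpace ℂ E]

lemma exists_norm_eq_one_mul_eq_norm (z : ℂ) : ∃ c : ℂ, ‖c‖ = 1 ∧ c * z = ‖z‖ := by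
  obtain ⟨c, hc, h⟩ := Complex.exists_norm_mul_eq_self z
  have hc0 : c ≠ 0 := by rintro rfl; simp at hc
  exact ⟨c⁻¹, by simp [hc], by rw [inv_mul_eq_iff_eq_mul₀ hc0, h]⟩

/-- A lower Lipschitz bound on orthogonal pairs extends to all aligned pairs. -/
lemma mul_norm_sub_le_of_inner_eq_ofReal (T : E →L[ℂ] EuclideanSpace ℂ ι) {κ : ℝ}
    (h : ∀ x y : E, inner ℂ x y = 0 → ‖x‖ ^ 2 + ‖y‖ ^ 2 = 1 →
      κ ≤ ‖absVec (T x) - absVec (T y)‖)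
    {x y : E} {r : ℝ} (hr : 0 ≤ r) (hxy : inner ℂ x y = (r : ℂ)) :
    κ * ‖x - y‖ ≤ ‖absVec (T x) - absVec (T y)‖ := by
  have hyx : inner ℂ y x = (r : ℂ) := by rw [← inner_conj_symm, hxy, Complex.conj_ofReal]
  rcases eq_or_ne (x - y) 0 with h0 | h0
  · simp [h0]
  have hv : 0 < ‖x - y‖ := norm_pos_iff.2 h0
  have hle : ‖x - y‖ ≤ ‖x + y‖ := by
    rw [← sq_le_sq₀ (norm_nonneg _) (norm_nonneg _), @norm_sub_sq ℂ, @norm_add_sq ℂ, hxy]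
    simp
    linarith
  have hu : 0 < ‖x + y‖ := hv.trans_le hle
  set v := x - y with hvdef
  set u := x + y with hudef
  let u' : E := ((2 * ‖u‖ : ℝ) : ℂ)⁻¹ • u
  let v' : E := ((2 * ‖v‖ : ℝ) : ℂ)⁻¹ • v
  have hu' : ‖u'‖ = 1 / 2 := by
    simp only [u', norm_smul, norm_inv, Complex.norm_real, norm_mul, norm_norm, Real.norm_ofNat]
    field_simp
  have hv' : ‖v'‖ = 1 / 2 := by
    simp only [v', norm_smul, norm_inv, Complex.norm_real, norm_mul, norm_norm, Real.norm_ofNat]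
    field_simp
  have huv : inner ℂ u v = inner ℂ v u := by
    simp only [hvdef, hudef, inner_add_left, inner_sub_left, inner_add_right, inner_sub_right,
      hxy, hyx]
    ring
  have huv' : inner ℂ u' v' = inner ℂ v' u' := by
    simp only [u', v', inner_smul_left, inner_smul_right, huv, map_inv₀, Complex.conj_ofReal]
    ring
  have horth : inner ℂ (u' + v') (u' - v') = (0 : ℂ) := by
    simp only [inner_add_left, inner_sub_right, huv', inner_self_eq_norm_sq_to_K, hu', hv']
    ring
  have hone : ‖u' + v'‖ ^ 2 + ‖u' - v'‖ ^ 2 = 1 := by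
    have := parallelogram_law_with_norm ℂ u' v'
    rw [hu', hv'] at this
    linarith
  have hx : x = (‖v‖ : ℂ) • (((‖u‖ / ‖v‖ : ℝ) : ℂ) • u' + v') := by
    have hvc : (‖v‖ : ℂ) ≠ 0 := by exact_mod_cast hv.ne'
    have huc : (‖u‖ : ℂ) ≠ 0 := by exact_mod_cast hu.ne'
    have h1 : (‖v‖ : ℂ) • (((‖u‖ / ‖v‖ : ℝ) : ℂ) • u' + v') = (1 / 2 : ℂ) • (u + v) := by
      simp only [u', v', smul_add, smul_smul]
      congr 2 <;> push_cast <;> field_simp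
    rw [h1, hudef, hvdef, add_add_sub_cancel, ← two_smul ℂ x, smul_smul]
    norm_num
  have hy : y = (‖v‖ : ℂ) • (((‖u‖ / ‖v‖ : ℝ) : ℂ) • u' - v') := by
    have hvc : (‖v‖ : ℂ) ≠ 0 := by exact_mod_cast hv.ne'
    have huc : (‖u‖ : ℂ) ≠ 0 := by exact_mod_cast hu.ne'
    have h1 : (‖v‖ : ℂ) • (((‖u‖ / ‖v‖ : ℝ) : ℂ) • u' - v') = (1 / 2 : ℂ) • (u - v) := by
      simp only [u', v', smul_sub, smul_smul]
      congr 2 <;> push_cast <;> field_simp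
    rw [h1, hudef, hvdef, add_sub_sub_cancel, ← two_smul ℂ y, smul_smul]
    norm_num
  clear_value u' v'
  have hTx : T x = (‖v‖ : ℂ) • (((‖u‖ / ‖v‖ : ℝ) : ℂ) • T u' + T v') := by
    rw [← map_smul, ← map_add, ← map_smul, ← hx]
  have hTy : T y = (‖v‖ : ℂ) • (((‖u‖ / ‖v‖ : ℝ) : ℂ) • T u' - T v') := by
    rw [← map_smul, ← map_sub, ← map_smul, ← hy]
  have hmono := norm_absVec_add_sub_absVec_sub_le (T u') (T v') ((one_le_div hv).2 hle)
  calc κ * ‖v‖ ≤ ‖absVec (T (u' + v')) - absVec (T (u' - v'))‖ * ‖v‖ := by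
        gcongr
        exact h _ _ horth hone
    _ ≤ ‖absVec (((‖u‖ / ‖v‖ : ℝ) : ℂ) • T u' + T v')
          - absVec (((‖u‖ / ‖v‖ : ℝ) : ℂ) • T u' - T v')‖ * ‖v‖ := by
        rw [map_add, map_sub]
        gcongr
    _ = ‖absVec (T x) - absVec (T y)‖ := by
        rw [hTx, hTy, absVec_smul, absVec_smul, ← smul_sub, norm_smul, norm_norm,
          Complex.norm_real, norm_norm, mul_comm]

lemma exists_mul_norm_sub_smul_le (T : E →L[ℂ] EuclideanSpace ℂ ι) {κ : ℝ}
    (h : ∀ x y : E, inner ℂ x y = 0 → ‖x‖ ^ 2 + ‖y‖ ^ 2 = 1 →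
      κ ≤ ‖absVec (T x) - absVec (T y)‖) (x y : E) :
    ∃ c : ℂ, ‖c‖ = 1 ∧ κ * ‖x - c • y‖ ≤ ‖absVec (T x) - absVec (T y)‖ := by
  obtain ⟨c, hc, hcz⟩ := exists_norm_eq_one_mul_eq_norm (inner ℂ x y)
  refine ⟨c, hc, ?_⟩
  have := mul_norm_sub_le_of_inner_eq_ofReal T h (x := x) (y := c • y)
    (norm_nonneg (inner ℂ x y)) (by rw [inner_smul_right, hcz])
  rwa [map_smul, absVec_smul, hc, one_smul] at this

lemma opNorm_le_of_net (T : E →L[ℂ] EuclideanSpace ℂ ι) {B η : ℝ} (hB : 0 ≤ B)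
    (hη : 0 ≤ η) (h : ∀ x : E, ‖x‖ = 1 → ∃ x₀, ‖x - x₀‖ ≤ η ∧ ‖T x₀‖ ≤ B) :
    ‖T‖ ≤ B + ‖T‖ * η := by
  refine ContinuousLinearMap.opNorm_le_of_unit_norm (by positivity) fun x hx => ?_
  obtain ⟨x₀, h1, h2⟩ := h x hx
  calc ‖T x‖ = ‖T x₀ + T (x - x₀)‖ := by rw [map_sub]; congr 1; abel
    _ ≤ ‖T x₀‖ + ‖T (x - x₀)‖ := norm_add_le _ _
    _ ≤ B + ‖T‖ * η := add_le_add h2 ((T.le_opNorm _).trans (by gcongr))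

end absVec

lemma gaussMatrixComplex_eq_pi (m n : ℕ) :
    gaussMatrixComplex m n = Measure.pi fun _ : Fin m => complexGaussianRow n := by
  have h : (Measure.pi fun _ : Fin n => (gaussianReal 0 (1/2)).prod (gaussianReal 0 (1/2))).map
      (fun g j => ((g j).1 : ℂ) + (g j).2 * Complex.I) = complexGaussianRow n := by
    have : ∀ _ : Fin n, SigmaFinite (((gaussianReal 0 (1/2)).prod (gaussianReal 0 (1/2))).map
        fun g : ℝ × ℝ => (g.1 : ℂ) + g.2 * Complex.I) := fun _ =>
      inferInstanceAs (SigmaFinite complexGaussian)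
    exact Measure.pi_map_pi fun _ => measurable_ofReal_add_ofReal_mul_I.aemeasurable
  have : ∀ _ : Fin m, SigmaFinite ((Measure.pi fun _ : Fin n =>
      (gaussianReal 0 (1/2)).prod (gaussianReal 0 (1/2))).map
        (fun g j => ((g j).1 : ℂ) + (g j).2 * Complex.I)) := fun _ => by
    rw [h]; infer_instance
  simp_rw [← h]
  exact Measure.pi_map_pi (f := fun _ : Fin m => fun (g : Fin n → ℝ × ℝ) j =>
    ((g j).1 : ℂ) + (g j).2 * Complex.I) fun _ => by fun_prop

lemma lpNorm_two_eq_norm {ι 𝕜 : Type*} [Fintype ι] [RCLike 𝕜] (x : ι → 𝕜) :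
    _root_.lpNorm 2 x = ‖WithLp.toLp 2 x‖ := by
  rw [EuclideanSpace.norm_eq, Real.sqrt_eq_rpow, _root_.lpNorm]
  simp

section matrixOp

variable {m n : ℕ}

/-- The continuous linear map `x ↦ A x` between Euclidean spaces. -/
noncomputable def matrixOp (A : Fin m → Fin n → ℂ) :
    EuclideanSpace ℂ (Fin n) →L[ℂ] EuclideanSpace ℂ (Fin m) :=
  LinearMap.toContinuousLinearMap (Matrix.toLpLin 2 2 (Matrix.of A))

lemma matrixOp_apply (A : Fin m → Fin n → ℂ) (x : EuclideanSpace ℂ (Fin n)) (i : Fin m) :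
    matrixOp A x i = ∑ j, A i j * x j := rfl

lemma sq_norm_absVec_matrixOp_sub (A : Fin m → Fin n → ℂ) (x y : EuclideanSpace ℂ (Fin n)) :
    ‖absVec (matrixOp A x) - absVec (matrixOp A y)‖ ^ 2
      = ∑ i, (‖∑ j, A i j * x j‖ - ‖∑ j, A i j * y j‖) ^ 2 := by
  simp [EuclideanSpace.norm_sq_eq, matrixOp_apply]

lemma sq_norm_matrixOp (A : Fin m → Fin n → ℂ) (x : EuclideanSpace ℂ (Fin n)) :
    ‖matrixOp A x‖ ^ 2 = ∑ i, ‖∑ j, A i j * x j‖ ^ 2 := by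
  simp [EuclideanSpace.norm_sq_eq, matrixOp_apply]

/-- An upper bound on the operator norm and a lower bound on normalized orthogonal pairs give the
phaseless bi-Lipschitz condition. -/
lemma phaselessBiLip_of_bounds {A : Fin m → Fin n → ℂ} {L U : ℝ} (hL : 0 ≤ L) (hU : 0 < U)
    (hA : ‖matrixOp A‖ ≤ U)
    (h : ∀ x y, inner ℂ x y = 0 → ‖x‖ ^ 2 + ‖y‖ ^ 2 = 1 →
      L ≤ ‖absVec (matrixOp A x) - absVec (matrixOp A y)‖) :
    PhaselessBiLip A Set.univ L U := by
  intro x _ y _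
  set x' : EuclideanSpace ℂ (Fin n) := WithLp.toLp 2 x with hx'
  set y' : EuclideanSpace ℂ (Fin n) := WithLp.toLp 2 y with hy'
  have h1 : _root_.lpNorm 2 (fun i => absMv A x i - absMv A y i)
      = ‖absVec (matrixOp A x') - absVec (matrixOp A y')‖ := lpNorm_two_eq_norm _
  have h2 (c : ℂ) : _root_.lpNorm 2 (fun i => x i - c * y i) = ‖x' - c • y'‖ :=
    lpNorm_two_eq_norm _
  rw [h1, phaseDist]
  simp only [h2]
  constructor
  · obtain ⟨c, hc, hcxy⟩ := exists_mul_norm_sub_smul_le (matrixOp A) h x' y'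
    refine le_trans (mul_le_mul_of_nonneg_left (csInf_le ⟨0, ?_⟩ ⟨c, hc, rfl⟩) hL) hcxy
    rintro _ ⟨c, -, rfl⟩
    exact norm_nonneg _
  · rw [← div_le_iff₀' hU]
    refine le_csInf ⟨_, 1, norm_one, rfl⟩ ?_
    rintro _ ⟨c, hc, rfl⟩
    rw [div_le_iff₀' hU]
    calc ‖absVec (matrixOp A x') - absVec (matrixOp A y')‖
        = ‖absVec (matrixOp A x') - absVec (matrixOp A (c • y'))‖ := by
          rw [map_smul, absVec_smul, hc, one_smul]
      _ ≤ ‖matrixOp A (x' - c • y')‖ := by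
          rw [map_sub]; exact norm_absVec_sub_le _ _
      _ ≤ U * ‖x' - c • y'‖ := (matrixOp A).le_of_opNorm_le hA _

end matrixOp

lemma sqrt_one_sub_pi_div_four_mem :
    0.46 ≤ √(1 - π / 4) ∧ √(1 - π / 4) ≤ 0.47 := by
  constructor
  · refine Real.le_sqrt_of_sq_le ?_
    linarith [Real.pi_lt_d2]
  · rw [Real.sqrt_le_left (by norm_num)]
    linarith [Real.pi_gt_d2]

lemma sqrt_four_div_four_sub_pi : √(4 / (4 - π)) = (√(1 - π / 4))⁻¹ := by
  rw [← Real.sqrt_inv]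
  congr 1
  have : 4 - π ≠ 0 := by linarith [Real.pi_lt_four]
  have : 1 - π / 4 ≠ 0 := by intro h; apply this; linarith
  field_simp

/-- The normalized orthogonal pairs of vectors. -/
def orthogonalPairs (n : ℕ) : Set (EuclideanSpace ℂ (Fin n) × EuclideanSpace ℂ (Fin n)) :=
  {p | inner ℂ p.1 p.2 = 0 ∧ ‖p.1‖ ^ 2 + ‖p.2‖ ^ 2 = 1}

lemma norm_le_one_of_mem_orthogonalPairs {n : ℕ}
    {p : EuclideanSpace ℂ (Fin n) × EuclideanSpace ℂ (Fin n)} (hp : p ∈ orthogonalPairs n) :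
    ‖p.1‖ ≤ 1 ∧ ‖p.2‖ ≤ 1 := by
  obtain ⟨-, h⟩ := hp
  constructor <;> nlinarith [norm_nonneg p.1, norm_nonneg p.2]

lemma exists_net_orthogonalPairs (n : ℕ) {η : ℝ} (hη : 0 < η) :
    ∃ s : Finset (EuclideanSpace ℂ (Fin n) × EuclideanSpace ℂ (Fin n)),
      (s.card : ℝ) ≤ (1 + 2 / η) ^ (4 * n) ∧ (∀ p ∈ s, p ∈ orthogonalPairs n) ∧
        ∀ p ∈ orthogonalPairs n, ∃ q ∈ s, ‖p.1 - q.1‖ ≤ η ∧ ‖p.2 - q.2‖ ≤ η := by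
  obtain ⟨s, hs, hsK, hnet⟩ := exists_net_of_norm_le_one hη (orthogonalPairs n) fun p hp =>
    max_le (norm_le_one_of_mem_orthogonalPairs hp).1 (norm_le_one_of_mem_orthogonalPairs hp).2
  have hd : Module.finrank ℝ (EuclideanSpace ℂ (Fin n) × EuclideanSpace ℂ (Fin n)) = 4 * n := by
    rw [finrank_real_of_complex, Module.finrank_prod, finrank_euclideanSpace_fin]
    ring
  rw [hd] at hs
  refine ⟨s, hs, hsK, fun p hp => ?_⟩
  obtain ⟨q, hq, hpq⟩ := hnet p hp
  exact ⟨q, hq, (le_max_left _ _).trans hpq, (le_max_right _ _).trans hpq⟩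

/-- If the upper and lower estimates hold on a net, then the phaseless bi-Lipschitz condition
holds with nearly optimal constants. -/
lemma exists_phaselessBiLip_of_net {m n : ℕ} (hm : 0 < m) {δ : ℝ} (h0 : 0 < δ) (h1 : δ < 0.05)
    (A : Fin m → Fin n → ℂ)
    (s : Set (EuclideanSpace ℂ (Fin n) × EuclideanSpace ℂ (Fin n)))
    (hs : ∀ p ∈ orthogonalPairs n, ∃ q ∈ s, ‖p.1 - q.1‖ ≤ δ / 128 ∧ ‖p.2 - q.2‖ ≤ δ / 128)
    (hlow : ∀ p ∈ s, m * (1 - π / 4 - δ / 80)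
      ≤ ∑ i, (‖∑ j, A i j * p.1 j‖ - ‖∑ j, A i j * p.2 j‖) ^ 2)
    (hupp : ∀ p ∈ s, ∑ i, ‖∑ j, A i j * p.1 j‖ ^ 2 ≤ m * (1 + δ / 80)) :
    ∃ L U : ℝ, 0 < L ∧ 0 < U ∧ √(4 / (4 - π)) ≤ U / L ∧ U / L ≤ √(4 / (4 - π)) + δ ∧
      PhaselessBiLip A Set.univ L U := by
  obtain ⟨hb1, hb2⟩ := sqrt_one_sub_pi_div_four_mem
  have hbsq : √(1 - π / 4) ^ 2 = 1 - π / 4 :=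
    Real.sq_sqrt (by linarith [Real.pi_lt_four])
  set b := √(1 - π / 4) with hb
  have hm' : (0 : ℝ) < m := by exact_mod_cast hm
  have hr0 : 0 < √(m : ℝ) := Real.sqrt_pos.2 hm'
  have hr2 : √(m : ℝ) ^ 2 = m := Real.sq_sqrt hm'.le
  set r := √(m : ℝ) with hr
  have hnet : ∀ p ∈ s, ‖matrixOp A p.1‖ ≤ r * (1 + δ / 160) := fun p hp => by
    refine le_of_sq_le_sq ?_ (by positivity)
    rw [sq_norm_matrixOp, mul_pow, hr2]
    refine (hupp p hp).trans (mul_le_mul_of_nonneg_left ?_ hm'.le)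
    nlinarith
  have hop : ‖matrixOp A‖ ≤ r * (1 + δ / 160) + ‖matrixOp A‖ * (δ / 128) := by
    refine opNorm_le_of_net (matrixOp A) (by positivity) (by positivity) fun x hx => ?_
    obtain ⟨q, hq, hxq, -⟩ := hs (x, 0) ⟨by simp, by simp [hx]⟩
    exact ⟨q.1, hxq, hnet q hq⟩
  have hT : ‖matrixOp A‖ ≤ r * (1 + δ / 8) := by
    have h2 : ‖matrixOp A‖ * (1 - δ / 128) ≤ r * (1 + δ / 160) := by linarith
    have h3 : r * (1 + δ / 160) ≤ r * (1 + δ / 8) * (1 - δ / 128) := by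
      rw [mul_assoc]
      refine mul_le_mul_of_nonneg_left ?_ hr0.le
      nlinarith
    exact le_of_mul_le_mul_right (h2.trans h3) (by linarith)
  refine ⟨r * b * (1 - δ / 8), r * (1 + δ / 8), ?_, by positivity, ?_, ?_,
    phaselessBiLip_of_bounds ?_ (by positivity) hT ?_⟩
  · exact mul_pos (by positivity) (by linarith)
  · rw [sqrt_four_div_four_sub_pi, ← hb, inv_eq_one_div,
      div_le_div_iff₀ (by positivity) (mul_pos (by positivity) (by linarith))]
    nlinarith [mul_pos hr0 (show 0 < b by linarith)]
  · rw [sqrt_four_div_four_sub_pi, ← hb, div_le_iff₀ (mul_pos (by positivity) (by linarith))]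
    have h2 : (b⁻¹ + δ) * (r * b * (1 - δ / 8)) = r * ((1 + δ * b) * (1 - δ / 8)) := by
      field_simp
    rw [h2]
    refine mul_le_mul_of_nonneg_left ?_ hr0.le
    have h3 : 0 ≤ b - 1 / 4 - δ * b / 8 := by nlinarith
    nlinarith [mul_nonneg h0.le h3]
  · exact mul_nonneg (by positivity) (by linarith)
  · intro x y hxy hn
    obtain ⟨q, hq, hxq, hyq⟩ := hs (x, y) ⟨hxy, hn⟩
    have h2 : r * (b - 1.5 * (δ / 80))
        ≤ ‖absVec (matrixOp A q.1) - absVec (matrixOp A q.2)‖ := by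
      refine le_of_sq_le_sq ?_ (norm_nonneg _)
      rw [sq_norm_absVec_matrixOp_sub, mul_pow, hr2]
      refine le_trans (mul_le_mul_of_nonneg_left ?_ hm'.le) (hlow q hq)
      nlinarith
    have h3 := norm_absVec_sub_le_add (matrixOp A q.1) (matrixOp A q.2) (matrixOp A x)
      (matrixOp A y)
    have h4 : ∀ u v, ‖v - u‖ ≤ δ / 128 →
        ‖matrixOp A u - matrixOp A v‖ ≤ r * (1 + δ / 8) * (δ / 128) := fun u v huv => by
      rw [← map_sub]
      exact (matrixOp A).le_of_opNorm_le_of_le hT (by rwa [norm_sub_rev])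
    have h5 : r * b * (1 - δ / 8) ≤ r * (b - 1.5 * (δ / 80))
        - r * (1 + δ / 8) * (δ / 128) - r * (1 + δ / 8) * (δ / 128) := by
      have : r * b * (1 - δ / 8) = r * (b * (1 - δ / 8)) := by ring
      rw [this]
      have : r * (b - 1.5 * (δ / 80)) - r * (1 + δ / 8) * (δ / 128)
        - r * (1 + δ / 8) * (δ / 128) = r * (b - 1.5 * (δ / 80) - (1 + δ / 8) * (δ / 64)) := by
        ring
      rw [this]
      refine mul_le_mul_of_nonneg_left ?_ hr0.le
      nlinarith
    linarith [h4 _ _ hxq, h4 _ _ hyq]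

lemma one_add_div_pow_le_exp {δ : ℝ} (h0 : 0 < δ) (h1 : δ < 0.05) (n : ℕ) :
    (1 + 2 / (δ / 128)) ^ (4 * n) ≤ rexp (12 * n * Real.log (1 / δ)) := by
  have h2 : 1 + 2 / (δ / 128) ≤ (1 / δ) ^ 3 := by
    have h3 : 20 ≤ 1 / δ := by
      rw [le_div_iff₀ h0]; linarith
    have h4 : 2 / (δ / 128) = 256 * (1 / δ) := by field_simp; norm_num
    rw [h4]
    nlinarith [sq_nonneg (1 / δ - 20), mul_nonneg (sub_nonneg.2 h3) (sub_nonneg.2 h3)]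
  calc (1 + 2 / (δ / 128)) ^ (4 * n) ≤ ((1 / δ) ^ 3) ^ (4 * n) := by gcongr
    _ = rexp (12 * n * Real.log (1 / δ)) := by
      rw [← pow_mul, ← Real.rpow_natCast, Real.rpow_def_of_pos (by positivity)]
      congr 1
      push_cast
      ring

/-- The union bound over a finite set of pairs. -/
lemma one_sub_le_measure_of_net {m n : ℕ} {ε : ℝ} (hε : 0 ≤ ε) (hε1 : ε ≤ 1 / 2)
    (s : Finset (EuclideanSpace ℂ (Fin n) × EuclideanSpace ℂ (Fin n)))
    (hs : ∀ p ∈ s, p ∈ orthogonalPairs n) :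
    ENNReal.ofReal (1 - 2 * (s.card * rexp (-(m * ε ^ 2 / 4)))) ≤
      (Measure.pi fun _ : Fin m => complexGaussianRow n)
        {A | (∀ p ∈ s, m * (1 - π / 4 - ε)
          ≤ ∑ i, (‖∑ j, A i j * p.1 j‖ - ‖∑ j, A i j * p.2 j‖) ^ 2) ∧
          ∀ p ∈ s, ∑ i, ‖∑ j, A i j * p.1 j‖ ^ 2 ≤ m * (1 + ε)} := by
  set μ := Measure.pi fun _ : Fin m => complexGaussianRow n
  set G := {A : Fin m → Fin n → ℂ | (∀ p ∈ s, m * (1 - π / 4 - ε)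
          ≤ ∑ i, (‖∑ j, A i j * p.1 j‖ - ‖∑ j, A i j * p.2 j‖) ^ 2) ∧
          ∀ p ∈ s, ∑ i, ‖∑ j, A i j * p.1 j‖ ^ 2 ≤ m * (1 + ε)}
  let B (p : EuclideanSpace ℂ (Fin n) × EuclideanSpace ℂ (Fin n)) := {A : Fin m → Fin n → ℂ |
    ∑ i, (‖∑ j, A i j * p.1 j‖ - ‖∑ j, A i j * p.2 j‖) ^ 2 ≤ m * (1 - π / 4 - ε)} ∪
    {A | m * (1 + ε) ≤ ∑ i, ‖∑ j, A i j * p.1 j‖ ^ 2}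
  have hB : ∀ p ∈ s, μ.real (B p) ≤ 2 * rexp (-(m * ε ^ 2 / 4)) := fun p hp => by
    obtain ⟨hp1, hp2⟩ := hs p hp
    have h1 := measureReal_sum_sq_sub_le hp1 hp2 m hε
    have h2 := measureReal_le_sum_sq (norm_le_one_of_mem_orthogonalPairs (hs p hp)).1 m hε hε1
    exact (measureReal_union_le _ _).trans (by rw [two_mul]; exact add_le_add h1 h2)
  have hG : Gᶜ ⊆ ⋃ p ∈ s, B p := by
    intro A hA
    simp only [G, Set.mem_compl_iff, Set.mem_ofPred_eq, not_and_or, not_forall, not_le] at hA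
    simp only [Set.mem_iUnion, B, Set.mem_union, Set.mem_ofPred_eq]
    rcases hA with ⟨p, hp, h⟩ | ⟨p, hp, h⟩
    · exact ⟨p, hp, .inl h.le⟩
    · exact ⟨p, hp, .inr h.le⟩
  have hGc : μ.real Gᶜ ≤ 2 * (s.card * rexp (-(m * ε ^ 2 / 4))) :=
    calc μ.real Gᶜ ≤ μ.real (⋃ p ∈ s, B p) := measureReal_mono hG (measure_ne_top _ _)
      _ ≤ ∑ p ∈ s, μ.real (B p) := measureReal_biUnion_finset_le _ _
      _ ≤ s.card • (2 * rexp (-(m * ε ^ 2 / 4))) := Finset.sum_le_card_nsmul _ _ _ hB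
      _ = _ := by rw [nsmul_eq_mul]; ring
  have hu : 1 ≤ μ.real G + μ.real Gᶜ := by
    rw [← probReal_univ (μ := μ), ← Set.union_compl_self G]
    exact measureReal_union_le _ _
  rw [← ofReal_measureReal]
  exact ENNReal.ofReal_le_ofReal (by linarith)

/-- Theorem `thm: complex_beta`, complex case: a standard complex Gaussian
random matrix `A ∈ ℂ^{m×n}` with `m ≥ C·log(1/δ)·δ⁻²·n` satisfies, with probability at least
`1 - 2exp(-c·δ²·m)`, the phaseless bi-Lipschitz condition on all of `ℂ^n` with constants
`L, U` such that `√(4/(4-π)) ≤ U/L ≤ √(4/(4-π)) + δ`. -/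
theorem stmt16 :
    ∃ c C : ℝ, 0 < c ∧ 0 < C ∧
      ∀ δ : ℝ, 0 < δ → δ < 0.05 →
        ∀ m n : ℕ, 0 < m → 0 < n →
          C * Real.log (1 / δ) * δ⁻¹ ^ 2 * n ≤ m →
          ENNReal.ofReal (1 - 2 * Real.exp (-c * δ ^ 2 * m)) ≤
            gaussMatrixComplex m n
              {A : Fin m → Fin n → ℂ | ∃ L U : ℝ, 0 < L ∧ 0 < U ∧
                Real.sqrt (4 / (4 - π)) ≤ U / L ∧
                U / L ≤ Real.sqrt (4 / (4 - π)) + δ ∧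
                PhaselessBiLip A Set.univ L U} := by
  refine ⟨1 / 51200, 614400, by norm_num, by norm_num, fun δ h0 h1 m n hm _ hmn => ?_⟩
  obtain ⟨s, hcard, hsK, hnet⟩ := exists_net_orthogonalPairs n (show 0 < δ / 128 by positivity)
  have hprob := one_sub_le_measure_of_net (m := m) (ε := δ / 80) (by positivity) (by linarith) s hsK
  rw [gaussMatrixComplex_eq_pi]
  refine le_trans (ENNReal.ofReal_le_ofReal ?_) (hprob.trans (measure_mono ?_))
  · have hlog : 12 * n * Real.log (1 / δ) ≤ δ ^ 2 * m / 51200 := by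
      have h2 : δ ^ 2 * (614400 * Real.log (1 / δ) * δ⁻¹ ^ 2 * n) ≤ δ ^ 2 * m := by gcongr
      have h3 : δ ^ 2 * (614400 * Real.log (1 / δ) * δ⁻¹ ^ 2 * n)
          = 614400 * n * Real.log (1 / δ) := by
        field_simp
      linarith
    have h4 : s.card * rexp (-(m * (δ / 80) ^ 2 / 4)) ≤ rexp (-(1 / 51200) * δ ^ 2 * m) := by
      calc s.card * rexp (-(m * (δ / 80) ^ 2 / 4))
          ≤ rexp (12 * n * Real.log (1 / δ)) * rexp (-(m * (δ / 80) ^ 2 / 4)) := by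
            gcongr
            exact hcard.trans (one_add_div_pow_le_exp h0 h1 n)
        _ ≤ rexp (-(1 / 51200) * δ ^ 2 * m) := by
            rw [← Real.exp_add]
            gcongr
            linarith
    linarith
  · rintro A ⟨hlow, hupp⟩
    exact exists_phaselessBiLip_of_net hm h0 h1 A s hnet hlow hupp
end

section
/- There exist universal constants a, C₁, C₂, C̃₁, c̃₂ > 0 such that the following holds for all positive integers m, n with n ≥ (log 6)²·m and every vector y ∈ ℝ^m satisfying ‖y‖_∞ ≤ 1/√m and ‖y‖₂ ≤ √(log(en/m)/m). If A ∈ ℝ^{m×n} is a standard Gaussian random matrix, then with probability at least 1 − C̃₁·exp(−c̃₂·m) − exp(−√(m·n)) there exists a vector z̃ ∈ ℝ^n such that y = (1/√m)·A·z̃, ‖z̃‖₁ ≤ C₁, and ‖z̃‖₂ ≤ C₂/√k for every positive integer k ≤ a·m/log(en/m). -/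
open MeasureTheory ProbabilityTheory Real Finset

/-- The law of a standard Gaussian random matrix `A ∈ ℝ^{m×n}`: the product over the `m·n`
entries of the real Gaussian measure with mean `0` and variance `1`. -/
noncomputable def gaussMatrixReal (m n : ℕ) : Measure (Fin m → Fin n → ℝ) :=
  Measure.pi fun _ : Fin m => Measure.pi fun _ : Fin n => gaussianReal 0 1

lemma lintegral_prod_pi {ι α : Type*} [Fintype ι] [MeasurableSpace α] (μ : Measure α)
    [IsProbabilityMeasure μ] (f : ι → α → ENNReal) (hf : ∀ i, Measurable (f i)) :
    ∫⁻ x, ∏ i, f i (x i) ∂(Measure.pi fun _ : ι => μ) = ∏ i, ∫⁻ a, f i a ∂μ := by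
  have hind : iIndepFun (fun i (x : ι → α) => f i (x i)) (Measure.pi fun _ : ι => μ) :=
    iIndepFun_pi (X := f) fun i => (hf i).aemeasurable
  rw [lintegral_prod_eq_prod_lintegral_of_indepFun Finset.univ _ hind
    fun i => (hf i).comp (measurable_pi_apply i)]
  refine Finset.prod_congr rfl fun i _ => ?_
  exact ((measurePreserving_eval (fun _ : ι => μ) i).lintegral_comp (hf i))

lemma lintegral_exp_sq_gaussianReal {s : ℝ} (hs : s < 1 / 2) :
    ∫⁻ x, ENNReal.ofReal (exp (s * x ^ 2)) ∂(gaussianReal 0 1)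
      = ENNReal.ofReal (√(1 / (1 - 2 * s))) := by
  have hpos : 0 < 1 / 2 - s := by linarith
  rw [gaussianReal_of_var_ne_zero _ one_ne_zero,
    lintegral_withDensity_eq_lintegral_mul _ (measurable_gaussianPDF _ _) (by fun_prop)]
  have h : ∀ x : ℝ, (gaussianPDF 0 1 * fun x => ENNReal.ofReal (exp (s * x ^ 2))) x
      = ENNReal.ofReal ((√(2 * π))⁻¹ * exp (-(1 / 2 - s) * x ^ 2)) := by
    intro x
    simp only [Pi.mul_apply, gaussianPDF, gaussianPDFReal]
    rw [← ENNReal.ofReal_mul (by positivity), mul_assoc, ← Real.exp_add]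
    simp only [NNReal.coe_one, mul_one, sub_zero]
    ring_nf
  simp_rw [h]
  rw [← ofReal_integral_eq_lintegral_ofReal]
  · rw [integral_const_mul, integral_gaussian, ← Real.sqrt_inv, ← Real.sqrt_mul (by positivity)]
    congr 2
    have := Real.pi_pos
    have h2 : 1 - 2 * s ≠ 0 := by linarith
    have h3 : 1 / 2 - s ≠ 0 := hpos.ne'
    field_simp
  · exact (integrable_exp_neg_mul_sq hpos).const_mul _
  · exact Filter.Eventually.of_forall fun x => by positivity

/-- The law of a vector in `ℝⁿ` with independent standard Gaussian coordinates. -/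
noncomputable def gaussVec (n : ℕ) : Measure (Fin n → ℝ) :=
  Measure.pi fun _ : Fin n => gaussianReal 0 1

instance (n : ℕ) : IsProbabilityMeasure (gaussVec n) := by
  unfold gaussVec; infer_instance

instance (m n : ℕ) : IsProbabilityMeasure (gaussMatrixReal m n) := by
  unfold gaussMatrixReal; infer_instance

lemma gaussMatrixReal_eq_pi (m n : ℕ) :
    gaussMatrixReal m n = Measure.pi fun _ : Fin m => gaussVec n := rfl

/-- Sections of small measure give a product set of small measure. -/
lemma prod_apply_le {α β : Type*} [MeasurableSpace α] [MeasurableSpace β] (μ : Measure α)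
    (ν : Measure β) [IsProbabilityMeasure μ] [IsProbabilityMeasure ν] {s : Set (α × β)}
    (hs : MeasurableSet s) {c : ENNReal} (h : ∀ x, ν {y | (x, y) ∈ s} ≤ c) :
    μ.prod ν s ≤ c := by
  rw [Measure.prod_apply hs]
  calc ∫⁻ x, ν (Prod.mk x ⁻¹' s) ∂μ ≤ ∫⁻ _, c ∂μ := lintegral_mono h
    _ = c := by simp

lemma map_swap_gaussMatrixReal (m n : ℕ) :
    MeasurePreserving (fun (A : Fin m → Fin n → ℝ) j i => A i j)
      (gaussMatrixReal m n) (gaussMatrixReal n m) := by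
  have hc : ∀ a b : ℕ, MeasurePreserving (MeasurableEquiv.curry (Fin a) (Fin b) ℝ)
      (Measure.pi fun _ : Fin a × Fin b => gaussianReal 0 1) (gaussMatrixReal a b) := by
    intro a b
    refine ⟨(MeasurableEquiv.curry (Fin a) (Fin b) ℝ).measurable, ?_⟩
    have := Measure.infinitePi_map_curry (fun (_ : Fin a) (_ : Fin b) => gaussianReal 0 1)
    simp only [Measure.infinitePi_eq_pi] at this
    exact this
  have hs := measurePreserving_piCongrLeft (fun _ : Fin n × Fin m => gaussianReal 0 1)
    (Equiv.prodComm (Fin m) (Fin n))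
  exact ((hc n m).comp hs).comp ((hc m n).symm _)

/-- Standard Gaussian vectors are rotation invariant. -/
lemma measurePreserving_isometry_gaussVec (m : ℕ)
    (U : EuclideanSpace ℝ (Fin m) ≃ₗᵢ[ℝ] EuclideanSpace ℝ (Fin m)) :
    MeasurePreserving (fun x : Fin m → ℝ => WithLp.ofLp (U (WithLp.toLp 2 x)))
      (gaussVec m) (gaussVec m) := by
  have h1 : MeasurePreserving (MeasurableEquiv.toLp 2 (Fin m → ℝ)) (gaussVec m)
      (stdGaussian (EuclideanSpace ℝ (Fin m))) :=
    ⟨(MeasurableEquiv.toLp 2 (Fin m → ℝ)).measurable, map_pi_eq_stdGaussian⟩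
  have h2 : MeasurePreserving U (stdGaussian (EuclideanSpace ℝ (Fin m)))
      (stdGaussian (EuclideanSpace ℝ (Fin m))) :=
    ⟨U.continuous.measurable, stdGaussian_map U⟩
  exact ((h1.symm _).comp h2).comp h1

/-- Acting on the columns by a linear isometry preserves the Gaussian measure. -/
lemma measurePreserving_rotate (m n : ℕ)
    (U : EuclideanSpace ℝ (Fin m) ≃ₗᵢ[ℝ] EuclideanSpace ℝ (Fin m)) :
    MeasurePreserving
      (fun (A : Fin m → Fin n → ℝ) i j => U (WithLp.toLp 2 fun k => A k j) i)
      (gaussMatrixReal m n) (gaussMatrixReal m n) :=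
  ((map_swap_gaussMatrixReal n m).comp (measurePreserving_pi (fun _ => gaussVec m)
    (fun _ : Fin n => gaussVec m) (fun _ => measurePreserving_isometry_gaussVec m U))).comp
    (map_swap_gaussMatrixReal m n)

/-- Some isometry maps a given vector to a multiple of the first basis vector. -/
lemma exists_rotation_single (m : ℕ) (w : EuclideanSpace ℝ (Fin (m + 1))) :
    ∃ U : EuclideanSpace ℝ (Fin (m + 1)) ≃ₗᵢ[ℝ] EuclideanSpace ℝ (Fin (m + 1)),
      U w = EuclideanSpace.single 0 ‖w‖ := by
  by_cases hw : w = 0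
  · refine ⟨LinearIsometryEquiv.refl ℝ _, ?_⟩
    ext i
    simp [hw]
  have hn : ‖w‖ ≠ 0 := norm_ne_zero_iff.mpr hw
  have hv : Orthonormal ℝ (({0} : Set (Fin (m + 1))).domRestrict fun _ => ‖w‖⁻¹ • w) := by
    rw [orthonormal_iff_ite]
    rintro ⟨i, rfl⟩ ⟨j, rfl⟩
    simp [Set.domRestrict, norm_smul, hn]
  obtain ⟨b, hb⟩ := hv.exists_orthonormalBasis_extension_of_card_eq (by simp)
  refine ⟨b.repr, ?_⟩
  have h0 : w = ‖w‖ • b 0 := by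
    rw [hb 0 rfl, smul_smul, mul_inv_cancel₀ hn, one_smul]
  conv_lhs => rw [h0]
  rw [map_smul, b.repr_self]
  ext i
  simp

/-- Markov's inequality for a function bounded below on a set. -/
lemma measure_le_of_lintegral_le {α : Type*} [MeasurableSpace α] (μ : Measure α) {s : Set α}
    {F : α → ENNReal} (hF : Measurable F) {c I : ℝ} (hc : 0 < c)
    (hs : ∀ x ∈ s, ENNReal.ofReal c ≤ F x) (hI : ∫⁻ x, F x ∂μ ≤ ENNReal.ofReal I) :
    μ s ≤ ENNReal.ofReal (I / c) := by
  have hc' : ENNReal.ofReal c ≠ 0 := by simpa using hc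
  calc μ s ≤ μ {x | ENNReal.ofReal c ≤ F x} := measure_mono hs
    _ ≤ (∫⁻ x, F x ∂μ) / ENNReal.ofReal c :=
        meas_ge_le_lintegral_div hF.aemeasurable hc' ENNReal.ofReal_ne_top
    _ ≤ ENNReal.ofReal I / ENNReal.ofReal c := by gcongr
    _ = ENNReal.ofReal (I / c) := (ENNReal.ofReal_div_of_pos hc).symm

/-- Lower tail of the sum of `m` squares among the coordinates of a Gaussian vector. -/
lemma gaussVec_sum_sq_lt (m n : ℕ) (hmn : m ≤ n) :
    gaussVec n {x | ∑ i ∈ univ.filter (fun i : Fin n => i.val < m), x i ^ 2 < (m : ℝ) / 6}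
      ≤ ENNReal.ofReal (exp (-(m / 4))) := by
  have hcard : (univ.filter (fun i : Fin n => i.val < m)).card = m := by
    rw [Fin.card_filter_val_lt, min_eq_right hmn]
  set F : (Fin n → ℝ) → ENNReal := fun x =>
    ∏ i, (if i.val < m then ENNReal.ofReal (exp (-(3 / 2) * x i ^ 2)) else 1) with hF
  have hint : ∫⁻ x, F x ∂(gaussVec n) = ENNReal.ofReal ((1 / 2) ^ m) := by
    rw [hF, gaussVec, lintegral_prod_pi (gaussianReal 0 1)
      (fun (i : Fin n) t => if i.val < m then ENNReal.ofReal (exp (-(3 / 2) * t ^ 2)) else 1)]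
    · have : ∀ i : Fin n, ∫⁻ t, (if i.val < m then ENNReal.ofReal (exp (-(3 / 2) * t ^ 2)) else 1)
          ∂(gaussianReal 0 1) = if i.val < m then ENNReal.ofReal (1 / 2) else 1 := by
        intro i
        split_ifs
        · rw [lintegral_exp_sq_gaussianReal (by norm_num)]
          congr 1
          rw [show (1 : ℝ) / (1 - 2 * (-(3 / 2))) = (1 / 2) ^ 2 by norm_num]
          exact Real.sqrt_sq (by norm_num)
        · simp
      simp_rw [this]
      rw [Finset.prod_ite, Finset.prod_const, Finset.prod_const_one, mul_one, hcard,
        ENNReal.ofReal_pow (by norm_num)]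
    · intro i
      split_ifs <;> fun_prop
  have hmeas : Measurable F := by
    rw [hF]
    refine Finset.measurable_prod _ fun i _ => ?_
    split_ifs <;> fun_prop
  refine (measure_le_of_lintegral_le (gaussVec n) hmeas (exp_pos (-(m / 4))) ?_ hint.le).trans ?_
  · intro x hx
    have : F x = ENNReal.ofReal (exp (-(3 / 2) *
        ∑ i ∈ univ.filter (fun i : Fin n => i.val < m), x i ^ 2)) := by
      rw [hF, Finset.mul_sum, Real.exp_sum, ENNReal.ofReal_prod_of_nonneg fun _ _ => (exp_pos _).le,
        Finset.prod_filter]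
    rw [this]
    refine ENNReal.ofReal_le_ofReal (exp_le_exp.mpr ?_)
    have h : ∑ i ∈ univ.filter (fun i : Fin n => i.val < m), x i ^ 2 < (m : ℝ) / 6 := hx
    linarith
  · refine ENNReal.ofReal_le_ofReal ?_
    rw [div_le_iff₀ (exp_pos _), ← Real.exp_add]
    have h1 : (1 / 2 : ℝ) ≤ exp (-(1 / 2)) := by
      linarith [Real.add_one_le_exp (-(1 / 2) : ℝ)]
    calc (1 / 2 : ℝ) ^ m ≤ exp (-(1 / 2)) ^ m := pow_le_pow_left₀ (by norm_num) h1 m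
      _ = exp (-(m / 4) + -(m / 4)) := by
        rw [← Real.exp_nat_mul]; congr 1; ring

/-- A Gaussian vector is rarely close to a subspace of codimension at least `m`. -/
lemma gaussVec_near_subspace (m n : ℕ) (V : Submodule ℝ (EuclideanSpace ℝ (Fin n)))
    (hV : Module.finrank ℝ V + m ≤ n) :
    gaussVec n {x | ∃ v ∈ V, ‖WithLp.toLp 2 x + v‖ ^ 2 < (m : ℝ) / 6}
      ≤ ENNReal.ofReal (exp (-(m / 4))) := by
  have hfr : m ≤ Module.finrank ℝ Vᗮ := by
    have := V.finrank_add_finrank_orthogonal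
    rw [finrank_euclideanSpace, Fintype.card_fin] at this
    omega
  set e := stdOrthonormalBasis ℝ Vᗮ
  set u : Fin n → EuclideanSpace ℝ (Fin n) := fun i =>
    if h : i.val < m then (e ⟨i.val, h.trans_le hfr⟩ : EuclideanSpace ℝ (Fin n)) else 0 with hu
  have horth : Orthonormal ℝ (({i : Fin n | i.val < m} : Set (Fin n)).domRestrict u) := by
    rw [orthonormal_iff_ite]
    rintro ⟨i, hi⟩ ⟨j, hj⟩
    change i.val < m at hi
    change j.val < m at hj
    simp only [Set.domRestrict, hu, hi, hj, dif_pos]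
    rw [← Submodule.coe_inner, orthonormal_iff_ite.mp e.orthonormal]
    simp [Fin.ext_iff]
  obtain ⟨b, hb⟩ := horth.exists_orthonormalBasis_extension_of_card_eq (by simp)
  have hbV : ∀ i : Fin n, i.val < m → ∀ v ∈ V, inner ℝ (b i) v = 0 := by
    intro i hi v hv
    rw [hb i hi, hu]
    simp only [hi, dif_pos]
    rw [real_inner_comm]
    exact (Submodule.mem_orthogonal V _).mp (e _).2 v hv
  have hU := measurePreserving_isometry_gaussVec n b.repr
  set T : Set (Fin n → ℝ) :=
    {x | ∑ i ∈ univ.filter (fun i : Fin n => i.val < m), x i ^ 2 < (m : ℝ) / 6}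
  calc gaussVec n {x | ∃ v ∈ V, ‖WithLp.toLp 2 x + v‖ ^ 2 < (m : ℝ) / 6}
      ≤ gaussVec n ((fun x : Fin n → ℝ => WithLp.ofLp (b.repr (WithLp.toLp 2 x))) ⁻¹' T) := by
        refine measure_mono ?_
        rintro x ⟨v, hv, hx⟩
        refine lt_of_le_of_lt ?_ hx
        rw [← b.repr.norm_map, EuclideanSpace.real_norm_sq_eq]
        refine le_trans (Finset.sum_le_sum fun i hi => ?_)
          (Finset.sum_le_sum_of_subset_of_nonneg (Finset.filter_subset _ _)
            fun i _ _ => sq_nonneg _)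
        have hi' : i.val < m := (Finset.mem_filter.mp hi).2
        change b.repr (WithLp.toLp 2 x) i ^ 2 ≤ _
        rw [b.repr_apply_apply, b.repr_apply_apply, inner_add_right, hbV i hi' v hv, add_zero]
    _ ≤ (gaussVec n).map _ T := Measure.le_map_apply hU.measurable.aemeasurable T
    _ = gaussVec n T := by rw [hU.map_eq]
    _ ≤ _ := gaussVec_sum_sq_lt m n (by omega)

/-- A unit linear functional of a Gaussian vector is a standard Gaussian. -/
lemma measurePreserving_sum_mul_gaussVec (n : ℕ) (z : Fin n → ℝ) (hz : ∑ j, z j ^ 2 = 1) :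
    MeasurePreserving (fun x : Fin n → ℝ => ∑ j, x j * z j) (gaussVec n) (gaussianReal 0 1) := by
  refine ⟨by fun_prop, ?_⟩
  have hnorm : ‖(WithLp.toLp 2 z : EuclideanSpace ℝ (Fin n))‖ ^ 2 = 1 := by
    rw [EuclideanSpace.real_norm_sq_eq]; exact hz
  set L : StrongDual ℝ (EuclideanSpace ℝ (Fin n)) := innerSL ℝ (WithLp.toLp 2 z)
  have hL : ‖L‖ ^ 2 = 1 := by rw [innerSL_apply_norm, hnorm]
  have h := IsGaussian.map_eq_gaussianReal (μ := stdGaussian (EuclideanSpace ℝ (Fin n))) L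
  rw [integral_strongDual_stdGaussian, variance_dual_stdGaussian, hL, Real.toNNReal_one,
    ← map_pi_eq_stdGaussian, Measure.map_map L.continuous.measurable (by fun_prop)] at h
  rw [← h, gaussVec]
  congr 1

/-- Upper tail for the image of a fixed vector under a Gaussian matrix. -/
lemma gaussMatrixReal_image_large (m n : ℕ) (z : Fin n → ℝ) :
    gaussMatrixReal m n {B | 4 * ((m : ℝ) + 1) * ∑ j, z j ^ 2 < ∑ i, (∑ j, B i j * z j) ^ 2}
      ≤ ENNReal.ofReal (exp (-((m + 1) / 4))) := by
  set S := ∑ j, z j ^ 2 with hS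
  have hS0 : 0 ≤ S := Finset.sum_nonneg fun _ _ => sq_nonneg _
  rcases hS0.eq_or_lt with h0 | hpos
  · have hz : ∀ j, z j = 0 := by
      intro j
      have := (Finset.sum_eq_zero_iff_of_nonneg fun j _ => sq_nonneg (z j)).mp (hS ▸ h0.symm) j
        (Finset.mem_univ j)
      exact pow_eq_zero_iff (two_ne_zero) |>.mp this
    simp [hz, ← h0]
  set f : (Fin n → ℝ) → ENNReal := fun x =>
    ENNReal.ofReal (exp (3 / 8 * (∑ j, x j * (z j / √S)) ^ 2)) with hf
  have hfm : Measurable f := by rw [hf]; fun_prop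
  have hfint : ∫⁻ x, f x ∂(gaussVec n) = ENNReal.ofReal 2 := by
    have h1 : ∑ j, (z j / √S) ^ 2 = 1 := by
      simp_rw [div_pow, Real.sq_sqrt hS0, ← Finset.sum_div]
      exact div_self hpos.ne'
    have h2 := (measurePreserving_sum_mul_gaussVec n _ h1).lintegral_comp
      (f := fun t : ℝ => ENNReal.ofReal (exp (3 / 8 * t ^ 2))) (by fun_prop)
    rw [lintegral_exp_sq_gaussianReal (by norm_num)] at h2
    rw [hf, h2, show (1 : ℝ) / (1 - 2 * (3 / 8)) = 2 ^ 2 by norm_num, Real.sqrt_sq (by norm_num)]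
  have hF : ∫⁻ B, ∏ i, f (B i) ∂(gaussMatrixReal m n) = ENNReal.ofReal (2 ^ m) := by
    rw [gaussMatrixReal_eq_pi, lintegral_prod_pi (gaussVec n) (fun _ : Fin m => f) fun _ => hfm]
    simp [hfint]
  refine (measure_le_of_lintegral_le _ (Finset.measurable_prod _ fun i _ =>
    hfm.comp (measurable_pi_apply i)) (exp_pos (3 / 2 * (m + 1))) ?_ hF.le).trans ?_
  · intro B hB
    change _ ≤ ∏ i, f (B i)
    rw [hf, ← ENNReal.ofReal_prod_of_nonneg fun _ _ => (exp_pos _).le, ← Real.exp_sum]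
    refine ENNReal.ofReal_le_ofReal (exp_le_exp.mpr ?_)
    have h1 : ∀ i, 3 / 8 * (∑ j, B i j * (z j / √S)) ^ 2
        = 3 / 8 * ((∑ j, B i j * z j) ^ 2 / S) := by
      intro i
      simp_rw [← mul_div_assoc, ← Finset.sum_div, div_pow, Real.sq_sqrt hS0]
      rw [mul_div_assoc]
    simp_rw [h1]
    rw [← Finset.mul_sum, ← Finset.sum_div]
    have h2 : 4 * ((m : ℝ) + 1) ≤ (∑ i, (∑ j, B i j * z j) ^ 2) / S := by
      rw [le_div_iff₀ hpos]
      exact le_of_lt hB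
    linarith
  · refine ENNReal.ofReal_le_ofReal ?_
    rw [div_le_iff₀ (exp_pos _), ← Real.exp_add]
    have h2 : (2 : ℝ) ≤ exp 1 := by linarith [Real.exp_one_gt_d9]
    calc (2 : ℝ) ^ m ≤ exp 1 ^ m := pow_le_pow_left₀ (by norm_num) h2 m
      _ = exp m := by rw [← Real.exp_nat_mul, mul_one]
      _ ≤ _ := exp_le_exp.mpr (by linarith [(Nat.cast_nonneg m : (0 : ℝ) ≤ m)])

lemma gaussianReal_tail_ge {x : ℝ} (hx : 0 ≤ x) :
    (√(2 * π))⁻¹ * exp (-(x ^ 2 + 1)) ≤ (gaussianReal 0 1).real {t | x ≤ |t|} := by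
  have hsub : Set.Icc x (x + 1) ⊆ {t : ℝ | x ≤ |t|} := fun t ht => ht.1.trans (le_abs_self t)
  have hle : ENNReal.ofReal ((√(2 * π))⁻¹ * exp (-(x ^ 2 + 1)))
      ≤ gaussianReal 0 1 (Set.Icc x (x + 1)) := by
    rw [gaussianReal_apply _ one_ne_zero]
    calc ENNReal.ofReal ((√(2 * π))⁻¹ * exp (-(x ^ 2 + 1)))
        = ∫⁻ _ in Set.Icc x (x + 1), ENNReal.ofReal ((√(2 * π))⁻¹ * exp (-(x ^ 2 + 1))) := by
          simp
      _ ≤ ∫⁻ t in Set.Icc x (x + 1), gaussianPDF 0 1 t := by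
          refine setLIntegral_mono (measurable_gaussianPDF _ _) fun t ht => ?_
          simp only [gaussianPDF, gaussianPDFReal, NNReal.coe_one, mul_one, sub_zero]
          refine ENNReal.ofReal_le_ofReal ?_
          gcongr
          have h1 : t ^ 2 ≤ (x + 1) ^ 2 := pow_le_pow_left₀ (hx.trans ht.1) ht.2 2
          nlinarith [sq_nonneg (x - 1)]
  rw [measureReal_def]
  exact (ENNReal.ofReal_le_iff_le_toReal (measure_ne_top _ _)).mp (hle.trans (measure_mono hsub))

/-- Many coordinates of a Gaussian vector exceed a moderate threshold. -/
lemma gaussVec_few_large (n : ℕ) {x τ : ℝ} (hx : 0 ≤ x)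
    (hτ : 4 * τ ≤ n * ((√(2 * π))⁻¹ * exp (-(x ^ 2 + 1)))) :
    gaussVec n {g | ((univ.filter fun j => x ≤ |g j|).card : ℝ) < τ}
      ≤ ENNReal.ofReal (exp (-τ)) := by
  set p := (√(2 * π))⁻¹ * exp (-(x ^ 2 + 1)) with hp
  set S : Set ℝ := {t | x ≤ |t|} with hS
  have hSm : MeasurableSet S := measurableSet_le measurable_const (by fun_prop)
  set f : ℝ → ENNReal := fun t => if x ≤ |t| then ENNReal.ofReal (exp (-1)) else 1 with hf
  have hfm : Measurable f := Measurable.ite hSm measurable_const measurable_const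
  have hfint : ∫⁻ t, f t ∂(gaussianReal 0 1) ≤ ENNReal.ofReal (exp (-(p / 2))) := by
    have h1 : ∫⁻ t, f t ∂(gaussianReal 0 1) = ENNReal.ofReal (exp (-1)) * gaussianReal 0 1 S
        + gaussianReal 0 1 Sᶜ := by
      rw [← lintegral_add_compl f hSm]
      congr 1
      · rw [setLIntegral_congr_fun (f := f) (g := fun _ => ENNReal.ofReal (exp (-1))) hSm
          fun t ht => if_pos ht]
        simp
      · rw [setLIntegral_congr_fun (f := f) (g := fun _ => 1) hSm.compl fun t ht => if_neg ht]
        simp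
    rw [h1, ← ofReal_measureReal, ← ofReal_measureReal, ← ENNReal.ofReal_mul (exp_pos _).le,
      ← ENNReal.ofReal_add (by positivity) (by positivity), probReal_compl_eq_one_sub hSm]
    refine ENNReal.ofReal_le_ofReal ?_
    have h2 : p ≤ (gaussianReal 0 1).real S := gaussianReal_tail_ge hx
    have h3 : exp (-1) ≤ 1 / 2 := by
      rw [Real.exp_neg, one_div]
      exact inv_anti₀ (by norm_num) (by linarith [Real.exp_one_gt_d9])
    have h4 := Real.add_one_le_exp (-(p / 2))
    have h5 : 0 ≤ (gaussianReal 0 1).real S := measureReal_nonneg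
    nlinarith [mul_le_mul_of_nonneg_right h3 h5]
  have hF : ∫⁻ g, ∏ j, f (g j) ∂(gaussVec n) ≤ ENNReal.ofReal (exp (-(p / 2)) ^ n) := by
    rw [gaussVec, lintegral_prod_pi (gaussianReal 0 1) (fun _ : Fin n => f) fun _ => hfm,
      ENNReal.ofReal_pow (exp_pos _).le]
    simp only [Finset.prod_const, Finset.card_univ, Fintype.card_fin]
    gcongr
  refine (measure_le_of_lintegral_le _ (Finset.measurable_prod _ fun j _ =>
    hfm.comp (measurable_pi_apply j)) (exp_pos (-τ)) ?_ hF).trans ?_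
  · intro g hg
    have h1 : ∏ j, f (g j) = ENNReal.ofReal (exp (-((univ.filter fun j => x ≤ |g j|).card : ℝ))) := by
      rw [hf, Finset.prod_ite, Finset.prod_const, Finset.prod_const_one, mul_one,
        ← ENNReal.ofReal_pow (exp_pos _).le, ← Real.exp_nat_mul]
      simp
    change _ ≤ ∏ j, f (g j)
    rw [h1]
    exact ENNReal.ofReal_le_ofReal (exp_le_exp.mpr (neg_le_neg (le_of_lt hg)))
  · refine ENNReal.ofReal_le_ofReal ?_
    rw [div_le_iff₀ (exp_pos _), ← Real.exp_add, ← Real.exp_nat_mul]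
    exact exp_le_exp.mpr (by linarith)

/-- The pairs `(r, A)` for which `A z = r` has no solution with `m ‖z‖² ≤ 6 ‖r‖²`,
in dual form. -/
def unsolvable (m n : ℕ) : Set ((Fin m → ℝ) × (Fin m → Fin n → ℝ)) :=
  {p | ∃ u : Fin m → ℝ, 6 * (∑ i, p.1 i ^ 2) * ∑ j, (∑ i, p.2 i j * u i) ^ 2
    < m * (∑ i, u i * p.1 i) ^ 2}

lemma isOpen_unsolvable (m n : ℕ) : IsOpen (unsolvable m n) := by
  have : unsolvable m n = ⋃ u : Fin m → ℝ, {p | 6 * (∑ i, p.1 i ^ 2) *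
      ∑ j, (∑ i, p.2 i j * u i) ^ 2 < m * (∑ i, u i * p.1 i) ^ 2} := by
    ext p; simp [unsolvable]
  rw [this]
  exact isOpen_iUnion fun u => isOpen_lt (by fun_prop) (by fun_prop)

lemma exists_solution_of_notMem_unsolvable {m n : ℕ} (hm : 0 < m) {r : Fin m → ℝ}
    {A : Fin m → Fin n → ℝ} (h : (r, A) ∉ unsolvable m n) :
    ∃ z : Fin n → ℝ, (∀ i, ∑ j, A i j * z j = r i) ∧
      m * ∑ j, z j ^ 2 ≤ 6 * ∑ i, r i ^ 2 := by
  have hm' : (0 : ℝ) < m := by exact_mod_cast hm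
  have h' : ∀ u : Fin m → ℝ, m * (∑ i, u i * r i) ^ 2
      ≤ 6 * (∑ i, r i ^ 2) * ∑ j, (∑ i, A i j * u i) ^ 2 := by
    simpa [unsolvable] using h
  set M : Matrix (Fin m) (Fin n) ℝ := Matrix.of A with hM
  set T : EuclideanSpace ℝ (Fin m) →ₗ[ℝ] EuclideanSpace ℝ (Fin m) :=
    Matrix.toEuclideanLin (M * M.transpose) with hT
  have hMt : ∀ u : Fin m → ℝ, ∀ j, (M.transpose.mulVec u) j = ∑ i, A i j * u i := fun u j => rfl
  have hTapp : ∀ u : EuclideanSpace ℝ (Fin m), ∀ i,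
      T u i = ∑ j, A i j * ∑ k, A k j * u k := by
    intro u i
    rw [hT, Matrix.toLpLin_apply]
    simp only [← Matrix.mulVec_mulVec]
    rfl
  have hin : ∀ u v : EuclideanSpace ℝ (Fin m),
      inner ℝ (T u) v = ∑ j, (∑ k, A k j * u k) * ∑ i, A i j * v i := by
    intro u v
    simp only [PiLp.inner_apply, hTapp, RCLike.inner_apply, conj_trivial, Finset.mul_sum,
      Finset.sum_mul]
    rw [Finset.sum_comm]
    refine Finset.sum_congr rfl fun j _ => ?_
    refine Finset.sum_congr rfl fun i _ => ?_
    refine Finset.sum_congr rfl fun k _ => ?_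
    ring
  have hsym : T.IsSymmetric := by
    intro u v
    rw [real_inner_comm (T v) u, hin, hin]
    exact Finset.sum_congr rfl fun j _ => mul_comm _ _
  have hr : WithLp.toLp 2 r ∈ LinearMap.range T := by
    rw [← Submodule.orthogonal_orthogonal (LinearMap.range T), hsym.orthogonal_range,
      Submodule.mem_orthogonal]
    intro u hu
    have h0 : ∑ j, (∑ i, A i j * u i) ^ 2 = 0 := by
      have := hin u u
      rw [LinearMap.mem_ker.mp hu, inner_zero_left] at this
      rw [this]
      exact Finset.sum_congr rfl fun j _ => sq _
    have h1 := h' u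
    rw [h0, mul_zero] at h1
    have h2 : (∑ i, u i * r i) ^ 2 ≤ 0 := by nlinarith
    have h3 : ∑ i, u i * r i = 0 := by nlinarith [sq_nonneg (∑ i, u i * r i)]
    simp only [PiLp.inner_apply, RCLike.inner_apply, conj_trivial]
    rw [← h3]
    exact Finset.sum_congr rfl fun i _ => mul_comm _ _
  obtain ⟨u, hu⟩ := hr
  refine ⟨fun j => ∑ i, A i j * u i, fun i => ?_, ?_⟩
  · rw [← hTapp, hu]
  · set Z := ∑ j, (∑ i, A i j * u i) ^ 2 with hZ
    have hZ0 : 0 ≤ Z := Finset.sum_nonneg fun _ _ => sq_nonneg _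
    have hur : ∑ i, u i * r i = Z := by
      have h4 := hin u u
      rw [hu] at h4
      simp only [PiLp.inner_apply, RCLike.inner_apply, conj_trivial] at h4
      rw [h4, hZ]
      exact Finset.sum_congr rfl fun j _ => (sq _).symm
    have h1 := h' u
    rw [hur] at h1
    rcases hZ0.eq_or_lt with h0 | hpos
    · rw [← h0, mul_zero]
      exact mul_nonneg (by norm_num) (Finset.sum_nonneg fun _ _ => sq_nonneg _)
    · have : (m * Z) * Z ≤ (6 * ∑ i, r i ^ 2) * Z := by nlinarith
      exact le_of_mul_le_mul_right this hpos

lemma unsolvable_single_le (m n : ℕ) (hn : m + (m + 1) ≤ n) (ρ : ℝ) :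
    gaussMatrixReal (m + 1) n {A | (Pi.single 0 ρ, A) ∈ unsolvable (m + 1) n}
      ≤ ENNReal.ofReal (exp (-(((m + 1 : ℕ) : ℝ) / 4))) := by
  set D : Set ((Fin n → ℝ) × (Fin m → Fin n → ℝ)) :=
    {p | ∃ v : Fin m → ℝ, ∑ j, (p.1 j + ∑ i, v i * p.2 i j) ^ 2 < ((m + 1 : ℕ) : ℝ) / 6} with hD
  have hDo : IsOpen D := by
    have : D = ⋃ v : Fin m → ℝ,
        {p | ∑ j, (p.1 j + ∑ i, v i * p.2 i j) ^ 2 < ((m + 1 : ℕ) : ℝ) / 6} := by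
      ext p; simp [hD]
    rw [this]
    exact isOpen_iUnion fun u => isOpen_lt (by fun_prop) (by fun_prop)
  have hmp := measurePreserving_piFinSuccAbove (fun _ : Fin (m + 1) => gaussVec n) 0
  have hsub : {A | (Pi.single 0 ρ, A) ∈ unsolvable (m + 1) n} ⊆
      MeasurableEquiv.piFinSuccAbove (fun _ : Fin (m + 1) => Fin n → ℝ) 0 ⁻¹' D := by
    rintro A ⟨u, hu⟩
    have h1 : ∑ i, (Pi.single 0 ρ : Fin (m + 1) → ℝ) i ^ 2 = ρ ^ 2 := by
      simp [Fin.sum_univ_succ]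
    have h2 : ∑ i, u i * (Pi.single 0 ρ : Fin (m + 1) → ℝ) i = u 0 * ρ := by
      simp [Fin.sum_univ_succ]
    simp only [h1, h2] at hu
    have hρ : ρ ≠ 0 := by rintro rfl; simp at hu
    have hρ2 : 0 < ρ ^ 2 := by positivity
    have hX : 0 ≤ ∑ j, (∑ i, A i j * u i) ^ 2 := Finset.sum_nonneg fun _ _ => sq_nonneg _
    have hlt : 6 * ∑ j, (∑ i, A i j * u i) ^ 2 < ((m + 1 : ℕ) : ℝ) * u 0 ^ 2 := by
      nlinarith
    have hu0 : u 0 ≠ 0 := by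
      intro h; rw [h] at hlt; norm_num at hlt; linarith
    have hu2 : 0 < u 0 ^ 2 := by positivity
    refine ⟨fun i => u i.succ / u 0, ?_⟩
    have h3 : ∀ j, A 0 j + ∑ i : Fin m, u i.succ / u 0 * A i.succ j
        = (∑ i, A i j * u i) / u 0 := by
      intro j
      rw [Fin.sum_univ_succ, add_div, mul_div_cancel_right₀ _ hu0, Finset.sum_div]
      congr 1
      exact Finset.sum_congr rfl fun i _ => by ring
    change ∑ j, (A 0 j + ∑ i : Fin m, u i.succ / u 0 * A i.succ j) ^ 2 < _
    simp_rw [h3, div_pow]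
    rw [← Finset.sum_div, div_lt_iff₀ hu2]
    linarith
  refine (measure_mono hsub).trans ?_
  rw [gaussMatrixReal_eq_pi, hmp.measure_preimage hDo.measurableSet.nullMeasurableSet,
    Measure.prod_apply_symm hDo.measurableSet]
  calc _ ≤ ∫⁻ _, ENNReal.ofReal (exp (-(((m + 1 : ℕ) : ℝ) / 4)))
        ∂(Measure.pi fun _ : Fin m => gaussVec n) := lintegral_mono fun B => ?_
    _ = _ := by simp
  set b : Fin m → EuclideanSpace ℝ (Fin n) := fun i => WithLp.toLp 2 (B i)
  refine (measure_mono ?_).trans (gaussVec_near_subspace (m + 1) n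
    (Submodule.span ℝ (Set.range b)) ?_)
  · rintro x ⟨v, hv⟩
    refine ⟨∑ i, v i • b i, Submodule.sum_mem _ fun i _ => Submodule.smul_mem _ _
      (Submodule.subset_span ⟨i, rfl⟩), ?_⟩
    rw [EuclideanSpace.real_norm_sq_eq]
    simpa [b] using hv
  · have := finrank_range_le_card (R := ℝ) b
    rw [Set.finrank, Fintype.card_fin] at this
    omega

/-- For a fixed right-hand side, a Gaussian system with at least about twice as many unknowns as
equations has a small solution with overwhelming probability. -/
lemma unsolvable_le (m n : ℕ) (hn : m + (m + 1) ≤ n) (r : Fin (m + 1) → ℝ) :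
    gaussMatrixReal (m + 1) n {A | (r, A) ∈ unsolvable (m + 1) n}
      ≤ ENNReal.ofReal (exp (-(((m + 1 : ℕ) : ℝ) / 4))) := by
  obtain ⟨U, hU⟩ := exists_rotation_single m (WithLp.toLp 2 r)
  set ρ := ‖(WithLp.toLp 2 r : EuclideanSpace ℝ (Fin (m + 1)))‖
  have hmp := measurePreserving_rotate (m + 1) n U
  refine le_trans ?_ (unsolvable_single_le m n hn ρ)
  conv_rhs => rw [← hmp.map_eq]
  refine le_trans (measure_mono ?_) (Measure.le_map_apply hmp.measurable.aemeasurable _)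
  rintro A ⟨u, hu⟩
  refine ⟨WithLp.ofLp (U (WithLp.toLp 2 u)), ?_⟩
  have hin : ∀ x y : Fin (m + 1) → ℝ,
      ∑ i, U (WithLp.toLp 2 x) i * U (WithLp.toLp 2 y) i = ∑ i, x i * y i := by
    intro x y
    have := U.inner_map_map (WithLp.toLp 2 y) (WithLp.toLp 2 x)
    simp only [PiLp.inner_apply, RCLike.inner_apply, conj_trivial] at this
    exact this
  have hr : ∀ i, (Pi.single 0 ρ : Fin (m + 1) → ℝ) i = U (WithLp.toLp 2 r) i := by
    intro i; rw [hU]; simp [Pi.single_apply]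
  simp only [hr, sq (U (WithLp.toLp 2 r) _), hin]
  simpa only [sq (r _)] using hu

lemma measurePreserving_split_gaussVec (n k : ℕ) :
    MeasurePreserving (fun x : Fin (n + k) → ℝ =>
      ((fun j => x (Fin.castAdd k j), fun j => x (Fin.natAdd n j)) :
        (Fin n → ℝ) × (Fin k → ℝ)))
      (gaussVec (n + k)) ((gaussVec n).prod (gaussVec k)) := by
  have h1 := (measurePreserving_piCongrLeft (fun _ : Fin (n + k) => gaussianReal 0 1)
    (finSumFinEquiv (m := n) (n := k))).symm _
  have h2 := measurePreserving_sumPiEquivProdPi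
    (X := fun _ : Fin n ⊕ Fin k => ℝ) (fun _ => gaussianReal 0 1)
  exact h2.comp h1

/-- Splitting the first row and the last `k` columns off a Gaussian matrix yields independent
Gaussian blocks. -/
lemma measurePreserving_split_gaussMatrixReal (m n k : ℕ) :
    MeasurePreserving (fun A : Fin (m + 1) → Fin (n + k) → ℝ =>
      (((fun j => A 0 (Fin.castAdd k j), fun i j => A i.succ (Fin.castAdd k j)),
        fun i j => A i (Fin.natAdd n j)) :
        ((Fin n → ℝ) × (Fin m → Fin n → ℝ)) × (Fin (m + 1) → Fin k → ℝ)))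
      (gaussMatrixReal (m + 1) (n + k))
      (((gaussVec n).prod (gaussMatrixReal m n)).prod (gaussMatrixReal (m + 1) k)) := by
  have h1 := measurePreserving_pi (fun _ : Fin (m + 1) => gaussVec (n + k)) _
    fun _ => measurePreserving_split_gaussVec n k
  have h2 := measurePreserving_arrowProdEquivProdArrow (Fin n → ℝ) (Fin k → ℝ) (Fin (m + 1))
    (fun _ => gaussVec n) (fun _ => gaussVec k)
  have h3 := measurePreserving_piFinSuccAbove (fun _ : Fin (m + 1) => gaussVec n) 0
  have : SFinite (gaussMatrixReal (m + 1) k) := inferInstance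
  exact ((h3.prod (MeasurePreserving.id (gaussMatrixReal (m + 1) k))).comp h2).comp h1

/-- The sign of `a`, set to zero when `|a| < x`. -/
noncomputable def cutSign (x a : ℝ) : ℝ := if x ≤ |a| then (if 0 ≤ a then 1 else -1) else 0

lemma measurable_cutSign (x : ℝ) : Measurable (cutSign x) :=
  Measurable.ite (measurableSet_le measurable_const (by fun_prop))
    (Measurable.ite measurableSet_Ici measurable_const measurable_const) measurable_const

lemma cutSign_sq (x a : ℝ) : cutSign x a ^ 2 = if x ≤ |a| then 1 else 0 := by
  unfold cutSign; split_ifs <;> norm_num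

lemma abs_cutSign (x a : ℝ) : |cutSign x a| = if x ≤ |a| then 1 else 0 := by
  unfold cutSign; split_ifs <;> norm_num

lemma mul_abs_cutSign_le (x a : ℝ) : x * |cutSign x a| ≤ a * cutSign x a := by
  rw [abs_cutSign]
  unfold cutSign
  split_ifs with h1 h2
  · rw [abs_of_nonneg h2] at h1; linarith
  · rw [abs_of_neg (not_le.mp h2)] at h1; linarith
  · simp

/-- Combining the truncated sign vector of the first row with a correction supported on the
last `k` columns. -/
lemma exists_small_solution_single {m n k : ℕ} (A : Fin (m + 1) → Fin (n + k) → ℝ) {x t δ s : ℝ}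
    (hx : 0 < x) (ht : 0 ≤ t) (htx : t ≤ x) (hδ : 0 < δ) (hk : (k : ℝ) ≤ 2 * (m + 1))
    {σ : Fin n → ℝ} (hσ : σ = fun j => cutSign x (A 0 (Fin.castAdd k j)))
    (hs : s = ((univ.filter fun j : Fin n => x ≤ |A 0 (Fin.castAdd k j)|).card : ℝ))
    (hlarge : δ * (m + 1) ≤ s)
    (himage : ∑ i : Fin m, (∑ j, A i.succ (Fin.castAdd k j) * σ j) ^ 2 ≤ 4 * ((m : ℝ) + 1) * s)
    (hsolve : ((Fin.cons 0 fun i => -∑ j, A i.succ (Fin.castAdd k j) * σ j : Fin (m + 1) → ℝ),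
      fun i j => A i (Fin.natAdd n j)) ∉ unsolvable (m + 1) k) :
    ∃ z : Fin (n + k) → ℝ, (∀ i, ∑ j, A i j * z j = (Pi.single 0 t : Fin (m + 1) → ℝ) i) ∧
      ∑ j, |z j| ≤ 1 + √(48 / δ) ∧ ∑ j, z j ^ 2 ≤ 25 / (δ * (m + 1)) := by
  have hm : (0 : ℝ) < m + 1 := by positivity
  have hspos : 0 < s := lt_of_lt_of_le (by positivity) hlarge
  have hσ2 : ∑ j, σ j ^ 2 = s := by
    simp [hσ, hs, cutSign_sq]
  have hσ1 : ∑ j, |σ j| = s := by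
    simp [hσ, hs, abs_cutSign]
  set T := ∑ j, A 0 (Fin.castAdd k j) * σ j with hT
  have hTs : x * s ≤ T := by
    rw [← hσ1, hT, Finset.mul_sum]
    refine Finset.sum_le_sum fun j _ => ?_
    rw [hσ]; exact mul_abs_cutSign_le _ _
  have hTpos : 0 < T := lt_of_lt_of_le (by positivity) hTs
  obtain ⟨z₂, hz₂, hz₂n⟩ := exists_solution_of_notMem_unsolvable m.succ_pos hsolve
  have hz₂sq : ∑ j, z₂ j ^ 2 ≤ 24 * s := by
    rw [Fin.sum_univ_succ] at hz₂n
    simp only [Fin.cons_zero, Fin.cons_succ, neg_sq, Nat.cast_succ] at hz₂n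
    have : (m + 1) * ∑ j, z₂ j ^ 2 ≤ (m + 1) * (24 * s) := by linarith
    exact le_of_mul_le_mul_left this hm
  have hz₂abs : ∑ j, |z₂ j| ≤ s * √(48 / δ) := by
    have h1 : (∑ j, |z₂ j|) ^ 2 ≤ k * ∑ j, z₂ j ^ 2 := by
      have := sq_sum_le_card_mul_sum_sq (s := (univ : Finset (Fin k))) (f := fun j => |z₂ j|)
      simpa using this
    have h2 : (k : ℝ) * ∑ j, z₂ j ^ 2 ≤ 2 * (m + 1) * (24 * s) :=
      mul_le_mul hk hz₂sq (Finset.sum_nonneg fun _ _ => sq_nonneg _) (by positivity)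
    have h3 : 2 * (m + 1) * (24 * s) ≤ s ^ 2 * (48 / δ) := by
      rw [← mul_div_assoc, le_div_iff₀ hδ]
      nlinarith
    have h4 : ∑ j, |z₂ j| ≤ √(s ^ 2 * (48 / δ)) := Real.le_sqrt_of_sq_le (by linarith)
    rwa [Real.sqrt_mul (sq_nonneg _), Real.sqrt_sq hspos.le] at h4
  set c := t / T with hc
  have hc0 : 0 ≤ c := by positivity
  have hcs : c * s ≤ 1 := by
    rw [hc, div_mul_eq_mul_div, div_le_one hTpos]
    nlinarith
  have hcT : c * T = t := div_mul_cancel₀ _ hTpos.ne'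
  refine ⟨Fin.append (fun j => c * σ j) (fun j => c * z₂ j), ?_, ?_, ?_⟩
  · intro i
    rw [Fin.sum_univ_add]
    simp only [Fin.append_left, Fin.append_right]
    have h1 : ∀ (l : ℕ) (a b : Fin l → ℝ), ∑ j, a j * (c * b j) = c * ∑ j, a j * b j := by
      intro l a b
      rw [Finset.mul_sum]
      exact Finset.sum_congr rfl fun j _ => by ring
    rw [h1, h1, hz₂ i]
    refine Fin.cases ?_ (fun i => ?_) i
    · simp [hcT, ← hT]
    · simp
  · rw [Fin.sum_univ_add]
    simp only [Fin.append_left, Fin.append_right, abs_mul, abs_of_nonneg hc0]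
    rw [← Finset.mul_sum, ← Finset.mul_sum, hσ1]
    have := mul_le_mul_of_nonneg_left hz₂abs hc0
    nlinarith [Real.sqrt_nonneg (48 / δ)]
  · rw [Fin.sum_univ_add]
    simp only [Fin.append_left, Fin.append_right, mul_pow]
    rw [← Finset.mul_sum, ← Finset.mul_sum, hσ2, le_div_iff₀ (by positivity)]
    have h1 : c ^ 2 * s + c ^ 2 * ∑ j, z₂ j ^ 2 ≤ 25 * (c ^ 2 * s) := by
      nlinarith [sq_nonneg c]
    have h2 : 0 ≤ c ^ 2 * s := by positivity
    have h3 : (c * s) ^ 2 ≤ 1 := pow_le_one₀ (by positivity) hcs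
    calc _ ≤ 25 * (c ^ 2 * s) * (δ * (m + 1)) := mul_le_mul_of_nonneg_right h1 (by positivity)
      _ ≤ 25 * (c ^ 2 * s) * s := mul_le_mul_of_nonneg_left hlarge (by positivity)
      _ = 25 * (c * s) ^ 2 := by ring
      _ ≤ 25 := by linarith

/-- The matrices `A` for which `A z = w` has a solution with `‖z‖₁ ≤ a` and `‖z‖₂² ≤ b`. -/
def smallSolvable (m n : ℕ) (w : Fin m → ℝ) (a b : ℝ) : Set (Fin m → Fin n → ℝ) :=
  {A | ∃ z : Fin n → ℝ, (∀ i, ∑ j, A i j * z j = w i) ∧ ∑ j, |z j| ≤ a ∧ ∑ j, z j ^ 2 ≤ b}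

lemma compl_smallSolvable_single_le {m n k : ℕ} (hk : k = 2 * (m + 1)) {x t δ : ℝ} (hx : 0 < x)
    (ht : 0 ≤ t) (htx : t ≤ x) (hδ : 0 < δ) (hδ4 : δ ≤ 1 / 4)
    (hn : 4 * (δ * (m + 1)) ≤ n * ((√(2 * π))⁻¹ * exp (-(x ^ 2 + 1)))) :
    gaussMatrixReal (m + 1) (n + k)
        (smallSolvable (m + 1) (n + k) (Pi.single 0 t) (1 + √(48 / δ)) (25 / (δ * (m + 1))))ᶜ
      ≤ ENNReal.ofReal (3 * exp (-(δ * (m + 1)))) := by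
  have hm : (0 : ℝ) < m + 1 := by positivity
  have hq : ENNReal.ofReal (exp (-(((m : ℝ) + 1) / 4)))
      ≤ ENNReal.ofReal (exp (-(δ * (m + 1)))) :=
    ENNReal.ofReal_le_ofReal (exp_le_exp.mpr (by nlinarith))
  have hσm : Measurable fun p : (Fin n → ℝ) × (Fin m → Fin n → ℝ) => fun j => cutSign x (p.1 j) :=
    measurable_pi_lambda _ fun j =>
      (measurable_cutSign x).comp ((measurable_pi_apply j).comp measurable_fst)
  have hσj : ∀ j, Measurable fun p : (Fin n → ℝ) × (Fin m → Fin n → ℝ) => cutSign x (p.1 j) :=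
    fun j => (measurable_pi_apply j).comp hσm
  have hBσ : ∀ i, Measurable fun p : (Fin n → ℝ) × (Fin m → Fin n → ℝ) =>
      ∑ j, p.2 i j * cutSign x (p.1 j) := fun i =>
    Finset.measurable_sum _ fun j _ => Measurable.mul (by fun_prop) (hσj j)
  set few : Set (Fin n → ℝ) :=
    {g | ((univ.filter fun j => x ≤ |g j|).card : ℝ) < δ * (m + 1)}
  set big : Set ((Fin n → ℝ) × (Fin m → Fin n → ℝ)) :=
    {p | 4 * ((m : ℝ) + 1) * ∑ j, cutSign x (p.1 j) ^ 2
      < ∑ i, (∑ j, p.2 i j * cutSign x (p.1 j)) ^ 2} with hbig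
  set F : ((Fin n → ℝ) × (Fin m → Fin n → ℝ)) × (Fin (m + 1) → Fin k → ℝ) →
      (Fin (m + 1) → ℝ) × (Fin (m + 1) → Fin k → ℝ) := fun p =>
    (Fin.cons 0 fun i => -∑ j, p.1.2 i j * cutSign x (p.1.1 j), p.2) with hF
  have hFm : Measurable F := by
    refine Measurable.prodMk (measurable_pi_lambda _ fun i => ?_) measurable_snd
    refine Fin.cases ?_ (fun i => ?_) i
    · exact measurable_const
    · exact ((hBσ i).comp measurable_fst).neg
  have h1 : gaussVec n few ≤ ENNReal.ofReal (exp (-(δ * (m + 1)))) :=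
    gaussVec_few_large n hx.le hn
  have h2 : ((gaussVec n).prod (gaussMatrixReal m n)) big
      ≤ ENNReal.ofReal (exp (-(δ * (m + 1)))) := by
    refine (prod_apply_le _ _ ?_ fun g => ?_).trans hq
    · exact measurableSet_lt
        (measurable_const.mul (Finset.measurable_sum _ fun j _ => (hσj j).pow_const 2))
        (Finset.measurable_sum _ fun i _ => (hBσ i).pow_const 2)
    · exact gaussMatrixReal_image_large m n fun j => cutSign x (g j)
  have h3 : (((gaussVec n).prod (gaussMatrixReal m n)).prod (gaussMatrixReal (m + 1) k))
      (F ⁻¹' unsolvable (m + 1) k) ≤ ENNReal.ofReal (exp (-(δ * (m + 1)))) := by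
    refine (prod_apply_le _ _ (hFm (isOpen_unsolvable _ _).measurableSet) fun p => ?_).trans hq
    have := unsolvable_le m k (by omega)
      (Fin.cons 0 fun i => -∑ j, p.2 i j * cutSign x (p.1 j))
    rwa [Nat.cast_succ] at this
  have hΨ := measurePreserving_split_gaussMatrixReal m n k
  set Ψ := fun A : Fin (m + 1) → Fin (n + k) → ℝ =>
      (((fun j => A 0 (Fin.castAdd k j), fun i j => A i.succ (Fin.castAdd k j)),
        fun i j => A i (Fin.natAdd n j)) :
        ((Fin n → ℝ) × (Fin m → Fin n → ℝ)) × (Fin (m + 1) → Fin k → ℝ))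
  have hΨ1 := measurePreserving_fst.comp hΨ
  have hΨ2 := measurePreserving_fst.comp hΨ1
  have hle : ∀ {β : Type} [MeasurableSpace β] {ν : Measure β}
      {f : (Fin (m + 1) → Fin (n + k) → ℝ) → β},
      MeasurePreserving f (gaussMatrixReal (m + 1) (n + k)) ν → ∀ s,
        gaussMatrixReal (m + 1) (n + k) (f ⁻¹' s) ≤ ν s := by
    intro β _ ν f hf s
    rw [← hf.map_eq]
    exact Measure.le_map_apply hf.measurable.aemeasurable s
  have hsub : (smallSolvable (m + 1) (n + k) (Pi.single 0 t) (1 + √(48 / δ))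
      (25 / (δ * (m + 1))))ᶜ ⊆ ((Prod.fst ∘ Prod.fst ∘ Ψ) ⁻¹' few ∪ (Prod.fst ∘ Ψ) ⁻¹' big) ∪
        Ψ ⁻¹' (F ⁻¹' unsolvable (m + 1) k) := by
    intro A hA
    by_contra hcon
    simp only [Set.mem_union, not_or] at hcon
    obtain ⟨⟨ha, hb⟩, hc⟩ := hcon
    refine hA (exists_small_solution_single A hx ht htx hδ ?_ rfl rfl (not_lt.mp ha) ?_ hc)
    · rw [hk]; push_cast; exact le_rfl
    · refine (not_lt.mp hb).trans (le_of_eq ?_)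
      simp [Ψ, cutSign_sq]
  refine (measure_mono hsub).trans ((measure_union_le _ _).trans
    ((add_le_add (measure_union_le _ _) le_rfl).trans ((add_le_add (add_le_add
      ((hle hΨ2 few).trans h1) ((hle hΨ1 big).trans h2)) ((hle hΨ _).trans h3)).trans ?_)))
  rw [← ENNReal.ofReal_add (by positivity) (by positivity),
    ← ENNReal.ofReal_add (by positivity) (by positivity)]
  exact ENNReal.ofReal_le_ofReal (by linarith)

lemma compl_smallSolvable_le {m n k : ℕ} (hk : k = 2 * (m + 1)) {x δ : ℝ} (hx : 0 < x)
    (w : Fin (m + 1) → ℝ) (hw : ∑ i, w i ^ 2 ≤ x ^ 2) (hδ : 0 < δ) (hδ4 : δ ≤ 1 / 4)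
    (hn : 4 * (δ * (m + 1)) ≤ n * ((√(2 * π))⁻¹ * exp (-(x ^ 2 + 1)))) :
    gaussMatrixReal (m + 1) (n + k)
        (smallSolvable (m + 1) (n + k) w (1 + √(48 / δ)) (25 / (δ * (m + 1))))ᶜ
      ≤ ENNReal.ofReal (3 * exp (-(δ * (m + 1)))) := by
  obtain ⟨U, hU⟩ := exists_rotation_single m (WithLp.toLp 2 w)
  set t := ‖(WithLp.toLp 2 w : EuclideanSpace ℝ (Fin (m + 1)))‖ with ht
  have htx : t ≤ x := by
    refine le_of_sq_le_sq ?_ hx.le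
    rw [ht, EuclideanSpace.real_norm_sq_eq]
    exact hw
  have hmp := measurePreserving_rotate (m + 1) (n + k) U
  refine le_trans ?_ (compl_smallSolvable_single_le hk hx (norm_nonneg _) htx hδ hδ4 hn)
  conv_rhs => rw [← hmp.map_eq]
  refine le_trans (measure_mono ?_) (Measure.le_map_apply hmp.measurable.aemeasurable _)
  rintro A hA ⟨z, hz, hz'⟩
  refine hA ⟨z, ?_, hz'⟩
  have h : U (∑ j, z j • WithLp.toLp 2 fun k => A k j) = U (WithLp.toLp 2 w) := by
    rw [hU, map_sum]
    ext i
    have := hz i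
    simp only [map_smul, WithLp.ofLp_sum, Finset.sum_apply, PiLp.smul_apply, smul_eq_mul]
    simp only [mul_comm (z _)]
    rw [this]
    simp [Pi.single_apply, ht]
  have h' := U.injective h
  intro i
  have := congrArg (fun v : EuclideanSpace ℝ (Fin (m + 1)) => v i) h'
  simpa [mul_comm] using this

lemma three_le_log_six_sq : 3 ≤ Real.log 6 ^ 2 := by
  have h : 7 / 4 ≤ Real.log 6 := by
    rw [Real.le_log_iff_exp_le (by norm_num)]
    refine le_of_pow_le_pow_left₀ (n := 4) (by norm_num) (by norm_num) ?_
    rw [← Real.exp_nat_mul]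
    have h1 : ((4 : ℕ) : ℝ) * (7 / 4) = ((7 : ℕ) : ℝ) * 1 := by norm_num
    rw [h1, Real.exp_nat_mul]
    calc exp 1 ^ 7 ≤ 2.7182818286 ^ 7 :=
          pow_le_pow_left₀ (exp_pos 1).le Real.exp_one_lt_d9.le 7
      _ ≤ 6 ^ 4 := by norm_num
  nlinarith

lemma lpNorm_one_eq {ι : Type*} [Fintype ι] (x : ι → ℝ) : lpNorm 1 x = ∑ i, |x i| := by
  simp [_root_.lpNorm]

lemma lpNorm_two_eq {ι : Type*} [Fintype ι] (x : ι → ℝ) : lpNorm 2 x = √(∑ i, x i ^ 2) := by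
  simp [_root_.lpNorm, Real.sqrt_eq_rpow]

/-- Lemma `construction of x`: for `n ≥ (log 6)²·m` and any `y ∈ ℝ^m` with
`‖y‖_∞ ≤ 1/√m` and `‖y‖₂ ≤ √(log(en/m)/m)`, a standard Gaussian random matrix `A ∈ ℝ^{m×n}`
admits, with probability at least `1 - C̃₁·exp(-c̃₂ m) - exp(-√(mn))`, a vector `z̃ ∈ ℝ^n` with
`y = (1/√m)·A z̃`, `‖z̃‖₁ ≤ C₁`, and `‖z̃‖₂ ≤ C₂/√k` for every `k ≤ a·m/log(en/m)`. -/
theorem stmt19 :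
    ∃ a C₁ C₂ C₃ c₂ : ℝ, 0 < a ∧ 0 < C₁ ∧ 0 < C₂ ∧ 0 < C₃ ∧ 0 < c₂ ∧
      ∀ m n : ℕ, 0 < m → (Real.log 6) ^ 2 * m ≤ n →
        ∀ y : Fin m → ℝ,
          (⨆ i : Fin m, |y i|) ≤ 1 / Real.sqrt m →
          lpNorm 2 y ≤ Real.sqrt (Real.log (Real.exp 1 * n / m) / m) →
          ENNReal.ofReal (1 - C₃ * Real.exp (-c₂ * m) - Real.exp (-Real.sqrt (m * n))) ≤
            gaussMatrixReal m n
              {A : Fin m → Fin n → ℝ | ∃ zt : Fin n → ℝ,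
                (∀ i, y i = (1 / Real.sqrt m) * ∑ j, A i j * zt j) ∧
                lpNorm 1 zt ≤ C₁ ∧
                ∀ k : ℕ, 0 < k → (k : ℝ) ≤ a * m / Real.log (Real.exp 1 * n / m) →
                  lpNorm 2 zt ≤ C₂ / Real.sqrt k} := by
  set δ : ℝ := (√(2 * π))⁻¹ * exp (-2) / 12 with hδdef
  have hδ : 0 < δ := by positivity
  have hδ4 : δ ≤ 1 / 4 := by
    have h1 : (√(2 * π))⁻¹ ≤ 1 :=
      inv_le_one_of_one_le₀ (Real.one_le_sqrt.mpr (by linarith [Real.pi_gt_three]))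
    have h2 : exp (-2) ≤ 1 := Real.exp_le_one_iff.mpr (by norm_num)
    have h3 : (√(2 * π))⁻¹ * exp (-2) ≤ 1 := mul_le_one₀ h1 (exp_pos _).le h2
    rw [hδdef]; linarith
  refine ⟨1, 1 + √(48 / δ), √(25 / δ), 3, δ, one_pos, by positivity, by positivity, by norm_num,
    hδ, ?_⟩
  intro m n hm hn y _ hy
  obtain ⟨m, rfl⟩ : ∃ l, m = l + 1 := ⟨m - 1, by omega⟩
  have hM : (0 : ℝ) < ((m + 1 : ℕ) : ℝ) := by positivity
  have h3 : 3 * ((m + 1 : ℕ) : ℝ) ≤ n := by nlinarith [three_le_log_six_sq]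
  obtain ⟨N, rfl⟩ : ∃ N, n = N + 2 * (m + 1) := by
    refine ⟨n - 2 * (m + 1), ?_⟩
    have : 3 * (m + 1) ≤ n := by exact_mod_cast h3
    omega
  set M : ℝ := ((m + 1 : ℕ) : ℝ) with hMdef
  set n : ℕ := N + 2 * (m + 1) with hndef
  have hMm : M = m + 1 := by rw [hMdef]; push_cast; rfl
  have hNn : (n : ℝ) = N + 2 * M := by rw [hndef, hMdef]; push_cast; ring
  have hn0 : (0 : ℝ) < n := by linarith
  set L := Real.log (Real.exp 1 * n / M) with hL
  have hexpL : exp L = exp 1 * n / M := Real.exp_log (by positivity)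
  have hL1 : 1 ≤ L := by
    rw [hL, Real.le_log_iff_exp_le (by positivity), le_div_iff₀ hM]
    exact mul_le_mul_of_nonneg_left (by linarith) (exp_pos 1).le
  set w : Fin (m + 1) → ℝ := fun i => √M * y i with hw
  have hw2 : ∑ i, w i ^ 2 ≤ √L ^ 2 := by
    rw [lpNorm_two_eq, Real.sqrt_le_sqrt_iff (by positivity), le_div_iff₀ hM] at hy
    simp_rw [hw, mul_pow, Real.sq_sqrt hM.le]
    rw [← Finset.mul_sum, Real.sq_sqrt (by linarith)]
    linarith
  have hcond : 4 * (δ * (m + 1)) ≤ N * ((√(2 * π))⁻¹ * exp (-(√L ^ 2 + 1))) := by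
    have h1 : exp (-(√L ^ 2 + 1)) = exp (-2) * (M / n) := by
      rw [Real.sq_sqrt (by linarith), show -(L + 1) = -2 + 1 - L by ring, Real.exp_sub, hexpL,
        Real.exp_add]
      have := (exp_pos 1).ne'
      field_simp
    rw [h1, ← hMm, hδdef]
    have h2 : 1 / 3 ≤ (N : ℝ) / n := by
      rw [div_le_div_iff₀ (by norm_num) hn0]; linarith
    have h4 : 0 ≤ (√(2 * π))⁻¹ * exp (-2) * M := by positivity
    calc _ = (√(2 * π))⁻¹ * exp (-2) * M * (1 / 3) := by ring
      _ ≤ (√(2 * π))⁻¹ * exp (-2) * M * ((N : ℝ) / n) := mul_le_mul_of_nonneg_left h2 h4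
      _ = _ := by ring
  have hbad := compl_smallSolvable_le (m := m) (n := N) rfl (Real.sqrt_pos.mpr (by linarith)) w
    hw2 hδ hδ4 hcond
  rw [← hMm] at hbad
  set S := smallSolvable (m + 1) n w (1 + √(48 / δ)) (25 / (δ * M))
  have hS : ENNReal.ofReal (1 - 3 * exp (-δ * M)) ≤ gaussMatrixReal (m + 1) n S := by
    rw [ENNReal.ofReal_sub _ (by positivity), ENNReal.ofReal_one, tsub_le_iff_right, neg_mul]
    calc (1 : ENNReal) = gaussMatrixReal (m + 1) n (S ∪ Sᶜ) := by simp
      _ ≤ gaussMatrixReal (m + 1) n S + gaussMatrixReal (m + 1) n Sᶜ := measure_union_le _ _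
      _ ≤ _ := add_le_add le_rfl hbad
  refine (ENNReal.ofReal_le_ofReal (by linarith [exp_pos (-√(M * n))])).trans
    (hS.trans (measure_mono ?_))
  rintro A ⟨z, hz, hz1, hz2⟩
  refine ⟨z, fun i => ?_, by rwa [lpNorm_one_eq], fun k hk hkM => ?_⟩
  · rw [hz i, hw, ← mul_assoc, one_div, inv_mul_cancel₀ (Real.sqrt_pos.mpr hM).ne', one_mul]
  · have hk0 : (0 : ℝ) < k := by exact_mod_cast hk
    have hkM' : (k : ℝ) ≤ M := hkM.trans (by rw [one_mul]; exact div_le_self hM.le hL1)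
    rw [lpNorm_two_eq, ← Real.sqrt_div (by positivity)]
    refine Real.sqrt_le_sqrt (hz2.trans ?_)
    rw [div_div]
    gcongr
end
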